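/- arXiv:cs/0412108 — 2 statements merged into one kernel-verified Lean document; each statement's English description precedes it below -/
import Mathlib

section
/- For every probability distribution of the random vector X with E[‖X‖^2] < ∞, the derivative with respect to snr of the Kullback–Leibler divergence between the law of √snr · X + N and the law of N satisfies d/dsnr D(P_{√snr·X+N} ‖ P_N) = (1/2) · E[‖E[X | √snr · X + N]‖^2] for all snr > 0. -/
open MeasureTheory ProbabilityTheory Real Filter
open scoped ENNReal NNReal Topology

noncomputable section

open scoped Classical in
/-- Kullback–Leibler divergence `D(μ ‖ ν)` in nats, with values in `[0, ∞]`. -/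
def klDiv {α : Type*} [MeasurableSpace α] (μ ν : Measure α) : ℝ≥0∞ :=
  if μ ≪ ν ∧ Integrable (llr μ ν) μ then ENNReal.ofReal (∫ x, llr μ ν x ∂μ) else ⊤

/-- Mutual information `I(A; B)` in nats: the KL divergence of the joint law of `(A, B)`
from the product of its marginals. -/
def mutualInfo {Ω α β : Type*} [MeasurableSpace Ω] [MeasurableSpace α] [MeasurableSpace β]
    (μ : Measure Ω) (A : Ω → α) (B : Ω → β) : ℝ≥0∞ :=
  klDiv (μ.map fun ω => (A ω, B ω)) ((μ.map A).prod (μ.map B))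


section Aux
variable {L : ℕ}

/-- Unnormalised Gaussian kernel. -/
def kk (r : ℝ) (y x : Fin L → ℝ) : ℝ := Real.exp (-(∑ l, (y l - r * x l) ^ 2) / 2)

/-- Smoothed kernel. -/
def KK (P : Measure (Fin L → ℝ)) (r : ℝ) (y : Fin L → ℝ) : ℝ := ∫ x, kk r y x ∂P

/-- First moment of the kernel. -/
def BB (P : Measure (Fin L → ℝ)) (l : Fin L) (r : ℝ) (y : Fin L → ℝ) : ℝ :=
  ∫ x, x l * kk r y x ∂P

/-- Log-density with respect to the Gaussian. -/
def hh (P : Measure (Fin L → ℝ)) (r : ℝ) (y : Fin L → ℝ) : ℝ :=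
  (∑ l, y l ^ 2) / 2 + Real.log (KK P r y)

/-- Posterior mean. -/
def gg (P : Measure (Fin L → ℝ)) (l : Fin L) (r : ℝ) (y : Fin L → ℝ) : ℝ :=
  BB P l r y / KK P r y

lemma kk_pos (r : ℝ) (y x : Fin L → ℝ) : 0 < kk r y x := Real.exp_pos _

lemma kk_le_one (r : ℝ) (y x : Fin L → ℝ) : kk r y x ≤ 1 := by
  unfold kk
  rw [Real.exp_le_one_iff]
  have : 0 ≤ ∑ l, (y l - r * x l) ^ 2 := Finset.sum_nonneg fun _ _ => sq_nonneg _
  linarith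

lemma kk_continuous : Continuous fun p : ℝ × (Fin L → ℝ) × (Fin L → ℝ) => kk p.1 p.2.1 p.2.2 := by
  unfold kk
  fun_prop

lemma kk_continuous' (x : Fin L → ℝ) :
    Continuous fun p : ℝ × (Fin L → ℝ) => kk p.1 p.2 x := by
  unfold kk
  fun_prop

lemma kk_measurable (r : ℝ) (y : Fin L → ℝ) : Measurable (kk r y) :=
  (kk_continuous.comp (by fun_prop : Continuous fun x : Fin L → ℝ => (r, y, x))).measurable

variable (P : Measure (Fin L → ℝ)) [IsProbabilityMeasure P]

lemma kk_integrable (r : ℝ) (y : Fin L → ℝ) : Integrable (kk r y) P := by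
  refine Integrable.of_bound (C := 1) (kk_measurable r y).aestronglyMeasurable (ae_of_all _ fun x => ?_)
  rw [Real.norm_eq_abs, abs_of_pos (kk_pos r y x)]
  exact kk_le_one r y x

lemma KK_pos (r : ℝ) (y : Fin L → ℝ) : 0 < KK P r y := by
  unfold KK
  rw [integral_pos_iff_support_of_nonneg (fun x => (kk_pos r y x).le) (kk_integrable P r y)]
  have : Function.support (kk r y) = Set.univ := by
    ext x; simp [(kk_pos r y x).ne']
  rw [this]; simp

lemma KK_le_one (r : ℝ) (y : Fin L → ℝ) : KK P r y ≤ 1 := by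
  have := integral_mono (kk_integrable P r y) (integrable_const (1:ℝ)) (fun x => kk_le_one r y x)
  simpa [KK] using this

lemma KK_continuous : Continuous fun p : ℝ × (Fin L → ℝ) => KK P p.1 p.2 := by
  unfold KK
  refine continuous_of_dominated (bound := fun _ => 1) ?_ ?_ (integrable_const _) ?_
  · intro p; exact (kk_measurable _ _).aestronglyMeasurable
  · intro p; refine ae_of_all _ fun x => ?_
    rw [Real.norm_eq_abs, abs_of_pos (kk_pos _ _ _)]
    exact kk_le_one _ _ _
  · refine ae_of_all _ fun x => ?_
    exact kk_continuous' x

variable {P}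

lemma xk_integrable (hP : ∀ l, Integrable (fun x : Fin L → ℝ => x l) P) (l : Fin L)
    (r : ℝ) (y : Fin L → ℝ) : Integrable (fun x => x l * kk r y x) P := by
  refine (hP l).norm.mono' ((measurable_pi_apply l).mul (kk_measurable r y)).aestronglyMeasurable
    (ae_of_all _ fun x => ?_)
  simp only [norm_mul, Real.norm_eq_abs, abs_of_pos (kk_pos r y x)]
  exact mul_le_of_le_one_right (abs_nonneg _) (kk_le_one r y x)

lemma BB_continuous (hP : ∀ l, Integrable (fun x : Fin L → ℝ => x l) P) (l : Fin L) :
    Continuous fun p : ℝ × (Fin L → ℝ) => BB P l p.1 p.2 := by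
  unfold BB
  refine continuous_of_dominated (bound := fun x => ‖x l‖) ?_ ?_ (hP l).norm ?_
  · intro p; exact (xk_integrable hP l _ _).aestronglyMeasurable
  · intro p; refine ae_of_all _ fun x => ?_
    rw [norm_mul, Real.norm_eq_abs (kk _ _ _), abs_of_pos (kk_pos _ _ _)]
    exact mul_le_of_le_one_right (norm_nonneg _) (kk_le_one _ _ x)
  · refine ae_of_all _ fun x => ?_
    exact continuous_const.mul
      (kk_continuous' x)

lemma gg_continuous (hP : ∀ l, Integrable (fun x : Fin L → ℝ => x l) P) (l : Fin L) :
    Continuous fun p : ℝ × (Fin L → ℝ) => gg P l p.1 p.2 :=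
  (BB_continuous hP l).div (KK_continuous P) fun _ => (KK_pos P _ _).ne'

variable (P) in
lemma hh_continuous : Continuous fun p : ℝ × (Fin L → ℝ) => hh P p.1 p.2 := by
  unfold hh
  refine Continuous.add (by fun_prop) ?_
  exact (KK_continuous P).log fun _ => (KK_pos P _ _).ne'

lemma abs_mul_exp_le (u : ℝ) (v : ℝ) (h : u ^ 2 ≤ v) : |u| * Real.exp (-v / 2) ≤ 1 := by
  have h1 : Real.exp (-v / 2) ≤ Real.exp (- u ^ 2 / 2) := by
    apply Real.exp_le_exp.2; linarith
  have h2 : |u| ≤ Real.exp (u ^ 2 / 2) := by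
    have := Real.add_one_le_exp (u ^ 2 / 2)
    nlinarith [sq_abs u, sq_nonneg (|u| - 1)]
  calc |u| * Real.exp (-v / 2) ≤ Real.exp (u ^ 2 / 2) * Real.exp (- u ^ 2 / 2) := by gcongr
    _ = 1 := by rw [← Real.exp_add]; simp; ring

lemma kk_hasDerivAt (r : ℝ) (x n x' : Fin L → ℝ) (t : ℝ) :
    HasDerivAt (fun t => kk r (fun l => t * x l + n l) x')
      ((-∑ l, x l * ((t * x l + n l) - r * x' l)) * kk r (fun l => t * x l + n l) x') t := by
  unfold kk
  have h : HasDerivAt (fun t => -(∑ l, ((t * x l + n l) - r * x' l) ^ 2) / 2)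
      (-(∑ l, 2 * ((t * x l + n l) - r * x' l) * x l) / 2) t := by
    refine HasDerivAt.div_const (HasDerivAt.neg (HasDerivAt.fun_sum fun l _ => ?_)) 2
    have h1 : HasDerivAt (fun t => (t * x l + n l) - r * x' l) (x l) t := by
      simpa using (((hasDerivAt_id t).mul_const (x l)).add_const (n l)).sub_const (r * x' l)
    simpa using h1.fun_pow 2
  convert h.exp using 1
  rw [mul_comm]
  congr 1
  rw [neg_div, Finset.sum_div]
  congr 1
  refine Finset.sum_congr rfl fun l _ => by ring

lemma KK_hasDerivAt (hP : ∀ l, Integrable (fun x : Fin L → ℝ => x l) P)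
    (r : ℝ) (x n : Fin L → ℝ) (t : ℝ) :
    HasDerivAt (fun t => KK P r (fun l => t * x l + n l))
      (∫ x', (-∑ l, x l * ((t * x l + n l) - r * x' l)) * kk r (fun l => t * x l + n l) x' ∂P) t := by
  unfold KK
  refine (hasDerivAt_integral_of_dominated_loc_of_deriv_le (μ := P) (s := Set.univ)
    (F := fun t x' => kk r (fun l => t * x l + n l) x')
    (F' := fun t x' =>
      (-∑ l, x l * ((t * x l + n l) - r * x' l)) * kk r (fun l => t * x l + n l) x')
    (x₀ := t) (bound := fun _ => ∑ l, |x l|)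
    Filter.univ_mem ?_ (kk_integrable P _ _) ?_ ?_ (integrable_const _) ?_).2
  · exact Filter.Eventually.of_forall fun t => (kk_measurable _ _).aestronglyMeasurable
  · refine (Measurable.mul ?_ (kk_measurable _ _)).aestronglyMeasurable
    fun_prop
  · refine ae_of_all _ fun x' t _ => ?_
    rw [norm_mul, Real.norm_eq_abs, Real.norm_eq_abs, abs_neg, abs_of_pos (kk_pos _ _ _)]
    calc _ ≤ (∑ l, |x l * ((t * x l + n l) - r * x' l)|) * kk r (fun l => t * x l + n l) x' :=
          mul_le_mul_of_nonneg_right (Finset.abs_sum_le_sum_abs _ _) (kk_pos _ _ _).le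
      _ ≤ _ := by
        rw [Finset.sum_mul]
        refine Finset.sum_le_sum fun l _ => ?_
        rw [abs_mul, mul_assoc]
        refine mul_le_of_le_one_right (abs_nonneg _) (abs_mul_exp_le _ _ ?_)
        exact Finset.single_le_sum (f := fun l => ((t * x l + n l) - r * x' l) ^ 2)
          (fun _ _ => sq_nonneg _) (Finset.mem_univ l)
  · exact ae_of_all _ fun x' t _ => kk_hasDerivAt r x n x' t

lemma hh_hasDerivAt (hP : ∀ l, Integrable (fun x : Fin L → ℝ => x l) P)
    (r : ℝ) (x n : Fin L → ℝ) (t : ℝ) :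
    HasDerivAt (fun t => hh P r (fun l => t * x l + n l))
      (∑ l, x l * (r * gg P l r (fun l => t * x l + n l))) t := by
  unfold hh
  have h1 : HasDerivAt (fun t => (∑ l, (t * x l + n l) ^ 2) / 2)
      ((∑ l, 2 * (t * x l + n l) * x l) / 2) t := by
    refine HasDerivAt.div_const (HasDerivAt.fun_sum fun l _ => ?_) 2
    have h1 : HasDerivAt (fun t => (t * x l + n l)) (x l) t := by
      simpa using ((hasDerivAt_id t).mul_const (x l)).add_const (n l)
    simpa using h1.fun_pow 2
  have h2 := (KK_hasDerivAt hP r x n t).log (KK_pos P _ _).ne'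
  refine (h1.fun_add h2).congr_deriv (Eq.symm ?_)
  set y : Fin L → ℝ := fun l => t * x l + n l with hy
  have hK := (KK_pos P r y).ne'
  have h3 : (∫ x', (-∑ l, x l * ((t * x l + n l) - r * x' l)) * kk r y x' ∂P)
      = ∑ l, x l * (r * BB P l r y - y l * KK P r y) := by
    have : ∀ x', (-∑ l, x l * ((t * x l + n l) - r * x' l)) * kk r y x'
        = ∑ l, x l * (r * (x' l * kk r y x') - y l * kk r y x') := by
      intro x'
      rw [← Finset.sum_neg_distrib, Finset.sum_mul]
      refine Finset.sum_congr rfl fun l _ => ?_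
      simp only [hy]; ring
    simp_rw [this]
    rw [integral_finsetSum]
    · refine Finset.sum_congr rfl fun l _ => ?_
      rw [integral_const_mul, integral_sub, integral_const_mul, integral_const_mul]
      · rfl
      · exact (xk_integrable hP l r y).const_mul _
      · exact (kk_integrable P r y).const_mul _
    · intro l _
      exact (((xk_integrable hP l r y).const_mul _).sub ((kk_integrable P r y).const_mul _)).const_mul _
  rw [h3, Finset.sum_div, Finset.sum_div, ← Finset.sum_add_distrib]
  refine Finset.sum_congr rfl fun l _ => ?_
  unfold gg
  simp only [hy] at hK ⊢
  field_simp
  ring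

/-- Chebyshev-association bound on the posterior mean. -/
lemma gg_bound (hP : ∀ l, Integrable (fun x : Fin L → ℝ => x l) P)
    (l : Fin L) (r : ℝ) (y : Fin L → ℝ) :
    |r * gg P l r y| ≤ 2 * ∑ j, |y j| + |r| * ∑ j, ∫ x, |x j| ∂P := by
  set φ : (Fin L → ℝ) → ℝ := fun x => Real.sqrt (∑ j, (y j - r * x j) ^ 2) with hφ
  have hφm : Measurable φ := by simp only [hφ]; fun_prop
  have hφ0 : ∀ x, 0 ≤ φ x := fun x => Real.sqrt_nonneg _
  have hφsq : ∀ x, φ x ^ 2 = ∑ j, (y j - r * x j) ^ 2 := fun x =>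
    Real.sq_sqrt (Finset.sum_nonneg fun _ _ => sq_nonneg _)
  have hφle : ∀ x, φ x ≤ ∑ j, (|y j| + |r| * |x j|) := by
    intro x
    have hS : 0 ≤ ∑ j, (|y j| + |r| * |x j|) := Finset.sum_nonneg fun j _ => by positivity
    refine (Real.sqrt_le_left hS).2 ?_
    calc ∑ j, (y j - r * x j) ^ 2 ≤ ∑ j, (|y j| + |r| * |x j|) ^ 2 := by
          refine Finset.sum_le_sum fun j _ => ?_
          rw [← sq_abs]
          gcongr
          rw [← abs_mul]
          exact abs_sub _ _
      _ ≤ _ := Finset.sum_sq_le_sq_sum_of_nonneg fun j _ => by positivity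
  have hint : Integrable (fun x : Fin L → ℝ => ∑ j, (|y j| + |r| * |x j|)) P :=
    integrable_finsetSum _ fun j _ => (integrable_const _).add ((hP j).abs.const_mul _)
  have hφi : Integrable φ P := hint.mono' hφm.aestronglyMeasurable
    (ae_of_all _ fun x => by rw [Real.norm_eq_abs, abs_of_nonneg (hφ0 x)]; exact hφle x)
  set c := ∫ x, φ x ∂P with hc
  have hc0 : 0 ≤ c := integral_nonneg hφ0
  have hcle : c ≤ ∑ j, |y j| + |r| * ∑ j, ∫ x, |x j| ∂P := by
    refine (integral_mono hφi hint hφle).trans (le_of_eq ?_)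
    rw [integral_finsetSum _ fun j _ => Integrable.fun_add (integrable_const _) ((hP j).abs.const_mul _)]
    rw [Finset.mul_sum, ← Finset.sum_add_distrib]
    refine Finset.sum_congr rfl fun j _ => ?_
    rw [integral_add (integrable_const _) ((hP j).abs.const_mul _), integral_const_mul]
    simp
  have hkφ : ∀ x, kk r y x = Real.exp (-φ x ^ 2 / 2) := fun x => by rw [kk, ← hφsq]
  have hφk : Integrable (fun x => φ x * kk r y x) P := by
    refine hφi.mono' (hφm.mul (kk_measurable r y)).aestronglyMeasurable (ae_of_all _ fun x => ?_)
    rw [Real.norm_eq_abs, abs_of_nonneg (mul_nonneg (hφ0 x) (kk_pos r y x).le)]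
    exact mul_le_of_le_one_right (hφ0 x) (kk_le_one r y x)
  have hpt : ∀ x, φ x * kk r y x ≤ c * kk r y x + (φ x - c) * Real.exp (-c ^ 2 / 2) := by
    intro x
    have : 0 ≤ (φ x - c) * (Real.exp (-c ^ 2 / 2) - kk r y x) := by
      rw [hkφ]
      rcases le_total c (φ x) with h | h
      · refine mul_nonneg (by linarith) (sub_nonneg.2 (Real.exp_le_exp.2 ?_))
        nlinarith
      · refine mul_nonneg_of_nonpos_of_nonpos (by linarith) (sub_nonpos.2 (Real.exp_le_exp.2 ?_))
        nlinarith [hφ0 x]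
    nlinarith
  have hcheb : ∫ x, φ x * kk r y x ∂P ≤ c * KK P r y := by
    have h1 : Integrable (fun x => c * kk r y x) P := (kk_integrable P r y).const_mul c
    have h2 : Integrable (fun x => (φ x - c) * Real.exp (-c ^ 2 / 2)) P :=
      (hφi.sub (integrable_const c)).mul_const _
    refine (integral_mono hφk (h1.add h2) hpt).trans (le_of_eq ?_)
    simp only [Pi.add_apply]
    rw [integral_add h1 h2, integral_const_mul, integral_mul_const,
      integral_sub hφi (integrable_const c)]
    simp [KK, ← hc]
  have hK := KK_pos P r y
  have hkey : |r * BB P l r y - y l * KK P r y| ≤ c * KK P r y := by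
    have h1 := xk_integrable hP l r y
    have h2 := kk_integrable P r y
    have : r * BB P l r y - y l * KK P r y = ∫ x, (r * x l - y l) * kk r y x ∂P := by
      unfold BB KK
      rw [← integral_const_mul, ← integral_const_mul,
        ← integral_sub (h1.const_mul r) (h2.const_mul (y l))]
      congr 1; ext x; ring
    rw [this]
    refine (abs_integral_le_integral_abs).trans (le_trans ?_ hcheb)
    refine integral_mono_of_nonneg (ae_of_all _ fun x => abs_nonneg _) hφk (ae_of_all _ fun x => ?_)
    simp only
    rw [abs_mul, abs_of_pos (kk_pos r y x)]
    refine mul_le_mul_of_nonneg_right (Real.abs_le_sqrt ?_) (kk_pos r y x).le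
    rw [← neg_sub, neg_sq]
    exact Finset.single_le_sum (f := fun l => (y l - r * x l) ^ 2)
          (fun _ _ => sq_nonneg _) (Finset.mem_univ l)
  have h4 : |r * gg P l r y - y l| ≤ c := by
    have : r * gg P l r y - y l = (r * BB P l r y - y l * KK P r y) / KK P r y := by
      unfold gg; field_simp
    rw [this, abs_div, abs_of_pos hK, div_le_iff₀ hK]
    exact hkey
  have h5 : |y l| ≤ ∑ j, |y j| :=
    Finset.single_le_sum (f := fun j => |y j|) (fun _ _ => abs_nonneg _) (Finset.mem_univ l)
  have h6 : |r * gg P l r y| ≤ |r * gg P l r y - y l| + |y l| := by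
    have := abs_add_le (r * gg P l r y - y l) (y l)
    simpa using this
  linarith

lemma hh_bound (hP2 : ∀ l, MemLp (fun x : Fin L → ℝ => x l) 2 P) (r : ℝ) (y : Fin L → ℝ) :
    |hh P r y| ≤ ∑ l, y l ^ 2 + r ^ 2 * ∑ l, ∫ x, x l ^ 2 ∂P := by
  have hsq : ∀ l, Integrable (fun x : Fin L → ℝ => x l ^ 2) P := fun l => (hP2 l).integrable_sq
  have hS : 0 ≤ ∑ l, y l ^ 2 := Finset.sum_nonneg fun _ _ => sq_nonneg _
  have hM : 0 ≤ r ^ 2 * ∑ l, ∫ x, x l ^ 2 ∂P :=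
    mul_nonneg (sq_nonneg _) (Finset.sum_nonneg fun l _ => integral_nonneg fun x => sq_nonneg _)
  set V : (Fin L → ℝ) → ℝ := fun x => (∑ l, (y l - r * x l) ^ 2) / 2 with hV
  have hVm : Measurable V := by simp only [hV]; fun_prop
  have hV0 : ∀ x, 0 ≤ V x := fun x => div_nonneg (Finset.sum_nonneg fun _ _ => sq_nonneg _) (by norm_num)
  have hVle : ∀ x, V x ≤ ∑ l, (y l ^ 2 + r ^ 2 * x l ^ 2) := by
    intro x
    simp only [hV]
    rw [Finset.sum_div]
    refine Finset.sum_le_sum fun l _ => ?_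
    nlinarith [sq_nonneg (y l + r * x l)]
  have hint : Integrable (fun x : Fin L → ℝ => ∑ l, (y l ^ 2 + r ^ 2 * x l ^ 2)) P :=
    integrable_finsetSum _ fun j _ => (integrable_const _).add ((hsq j).const_mul _)
  have hVi : Integrable V P := hint.mono' hVm.aestronglyMeasurable
    (ae_of_all _ fun x => by rw [Real.norm_eq_abs, abs_of_nonneg (hV0 x)]; exact hVle x)
  set c := ∫ x, V x ∂P with hc
  have hcle : c ≤ ∑ l, y l ^ 2 + r ^ 2 * ∑ l, ∫ x, x l ^ 2 ∂P := by
    refine (integral_mono hVi hint hVle).trans (le_of_eq ?_)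
    rw [integral_finsetSum _ fun j _ => Integrable.fun_add (integrable_const _) ((hsq j).const_mul _)]
    rw [Finset.mul_sum, ← Finset.sum_add_distrib]
    refine Finset.sum_congr rfl fun j _ => ?_
    rw [integral_add (integrable_const _) ((hsq j).const_mul _), integral_const_mul]
    simp
  have hKc : Real.exp (-c) ≤ KK P r y := by
    have hpt : ∀ x, Real.exp (-c) * (c - V x + 1) ≤ kk r y x := by
      intro x
      have h1 : kk r y x = Real.exp (-c) * Real.exp (c - V x) := by
        rw [← Real.exp_add, kk]; congr 1; simp only [hV]; ring
      rw [h1]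
      exact mul_le_mul_of_nonneg_left (Real.add_one_le_exp _) (Real.exp_pos _).le
    have hi : Integrable (fun x => c - V x) P := (integrable_const c).sub hVi
    have hi2 : Integrable (fun x => c - V x + 1) P := hi.add (integrable_const 1)
    have := integral_mono (hi2.const_mul (Real.exp (-c))) (kk_integrable P r y) hpt
    rw [integral_const_mul, integral_add hi (integrable_const 1),
      integral_sub (integrable_const c) hVi] at this
    simpa [← hc, KK] using this
  have h1 : -c ≤ Real.log (KK P r y) := by
    rw [Real.le_log_iff_exp_le (KK_pos P r y)]; exact hKc
  have h2 : Real.log (KK P r y) ≤ 0 := Real.log_nonpos (KK_pos P r y).le (KK_le_one P r y)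
  unfold hh
  rw [abs_le]
  constructor <;> linarith

end Aux

section Law
variable {L : ℕ}

/-- The standard Gaussian measure. -/
def stdG (L : ℕ) : Measure (Fin L → ℝ) := Measure.pi fun _ : Fin L => gaussianReal 0 1

instance : IsProbabilityMeasure (stdG L) := by unfold stdG; infer_instance

lemma gaussian_shift (v : ℝ) :
    gaussianReal v 1 = (gaussianReal 0 1).withDensity
      (fun y => ENNReal.ofReal (Real.exp (v * y - v ^ 2 / 2))) := by
  rw [gaussianReal_of_var_ne_zero _ one_ne_zero, gaussianReal_of_var_ne_zero _ one_ne_zero,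
    ← withDensity_mul _ (measurable_gaussianPDF 0 1) (by fun_prop)]
  congr 1
  ext y
  simp only [Pi.mul_apply, gaussianPDF]
  rw [← ENNReal.ofReal_mul (gaussianPDFReal_nonneg _ _ _)]
  congr 1
  simp only [gaussianPDFReal, mul_assoc]
  rw [← Real.exp_add]
  congr 2
  simp
  ring

lemma pi_withDensity' (f : Fin L → ℝ → ℝ≥0∞) (hf : ∀ l, Measurable (f l)) 
    (hsf : ∀ l, SigmaFinite ((gaussianReal 0 1).withDensity (f l))) :
    (stdG L).withDensity (fun y => ∏ l, f l (y l)) =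
      Measure.pi fun l => (gaussianReal 0 1).withDensity (f l) := by
  symm
  refine Measure.pi_eq fun s hs => ?_
  rw [withDensity_apply _ (MeasurableSet.univ_pi hs), ← lintegral_indicator (MeasurableSet.univ_pi hs)]
  have h1 : ∀ y : Fin L → ℝ, (Set.univ.pi s).indicator (fun y => ∏ l, f l (y l)) y
      = ∏ l, (s l).indicator (f l) (y l) := by
    intro y
    by_cases hy : y ∈ Set.univ.pi s
    · rw [Set.indicator_of_mem hy]
      refine Finset.prod_congr rfl fun l _ => ?_
      rw [Set.indicator_of_mem (hy l (Set.mem_univ l))]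
    · rw [Set.indicator_of_notMem hy]
      simp only [Set.mem_pi, Set.mem_univ, true_imp_iff, not_forall] at hy
      obtain ⟨l, hl⟩ := hy
      symm
      exact Finset.prod_eq_zero (Finset.mem_univ l) (Set.indicator_of_notMem hl _)
  simp_rw [h1]
  have hm : ∀ l, Measurable ((s l).indicator (f l)) := fun l => (hf l).indicator (hs l)
  unfold stdG
  have hind := iIndepFun_pi (μ := fun _ : Fin L => gaussianReal 0 1)
    (X := fun l => (s l).indicator (f l)) (fun l => (hm l).aemeasurable)
  rw [lintegral_prod_eq_prod_lintegral_of_indepFun _ _ hind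
    (fun l => (hm l).comp (measurable_pi_apply l))]
  refine Finset.prod_congr rfl fun l _ => ?_
  rw [withDensity_apply _ (hs l), ← lintegral_indicator (hs l)]
  exact (measurePreserving_eval (fun _ : Fin L => gaussianReal 0 1) l).lintegral_comp (hm l)

lemma stdG_shift (v : Fin L → ℝ) :
    (stdG L).map (fun n l => v l + n l) = (stdG L).withDensity
      (fun y => ENNReal.ofReal (Real.exp (∑ l, (v l * y l - v l ^ 2 / 2)))) := by
  have h1 : (stdG L).map (fun n l => v l + n l) = Measure.pi fun l => gaussianReal (v l) 1 := by
    unfold stdG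
    rw [Measure.pi_map_pi (f := fun l n => v l + n) (fun l => by fun_prop)]
    congr 1; ext1 l
    rw [gaussianReal_map_const_add, zero_add]
  have h2 : (fun y : Fin L → ℝ => ENNReal.ofReal (Real.exp (∑ l, (v l * y l - v l ^ 2 / 2))))
      = fun y => ∏ l, (fun u => ENNReal.ofReal (Real.exp (v l * u - v l ^ 2 / 2))) (y l) := by
    ext y
    rw [Real.exp_sum, ENNReal.ofReal_prod_of_nonneg fun _ _ => (Real.exp_pos _).le]
  rw [h1, h2, pi_withDensity' (fun l u => ENNReal.ofReal (Real.exp (v l * u - v l ^ 2 / 2)))]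
  · congr 1; ext1 l; exact gaussian_shift (v l)
  · intro l; fun_prop
  · intro l; rw [← gaussian_shift]; infer_instance

lemma exp_kk (r : ℝ) (x y : Fin L → ℝ) :
    Real.exp (∑ l, ((r * x l) * y l - (r * x l) ^ 2 / 2))
      = Real.exp ((∑ l, y l ^ 2) / 2) * kk r y x := by
  rw [kk, ← Real.exp_add]
  congr 1
  rw [Finset.sum_div, neg_div, Finset.sum_div, ← sub_eq_add_neg, ← Finset.sum_sub_distrib]
  exact Finset.sum_congr rfl fun l _ => by ring

lemma exp_hh (P : Measure (Fin L → ℝ)) [IsProbabilityMeasure P] (r : ℝ) (y : Fin L → ℝ) :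
    Real.exp (hh P r y) = Real.exp ((∑ l, y l ^ 2) / 2) * KK P r y := by
  rw [hh, Real.exp_add, Real.exp_log (KK_pos P r y)]

lemma dens_measurable (r : ℝ) : Measurable (fun p : (Fin L → ℝ) × (Fin L → ℝ) =>
    ENNReal.ofReal (Real.exp ((∑ l, p.2 l ^ 2) / 2) * kk r p.2 p.1)) := by
  unfold kk; fun_prop

lemma hh_measurable (P : Measure (Fin L → ℝ)) [IsProbabilityMeasure P] (r : ℝ) :
    Measurable (hh P r) :=
  ((hh_continuous P).comp (Continuous.prodMk_right r)).measurable

lemma gg_measurable {P : Measure (Fin L → ℝ)} [IsProbabilityMeasure P]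
    (hP : ∀ l, Integrable (fun x : Fin L → ℝ => x l) P) (l : Fin L) (r : ℝ) :
    Measurable (gg P l r) :=
  ((gg_continuous hP l).comp (Continuous.prodMk_right r)).measurable

variable {Ω : Type*} [MeasurableSpace Ω] {μ : Measure Ω} [IsProbabilityMeasure μ]
    {X N : Ω → Fin L → ℝ}

/-- The channel output. -/
def YY (X N : Ω → Fin L → ℝ) (r : ℝ) : Ω → Fin L → ℝ := fun ω l => r * X ω l + N ω l

lemma YY_measurable (hX : Measurable X) (hN : Measurable N) (r : ℝ) : Measurable (YY X N r) := by
  unfold YY; fun_prop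

lemma joint_law (hX : Measurable X) (hN : Measurable N) (hXN : IndepFun X N μ)
    (hN_law : μ.map N = stdG L) (r : ℝ) :
    μ.map (fun ω => (X ω, YY X N r ω)) = ((μ.map X).prod (stdG L)).withDensity
      (fun p => ENNReal.ofReal (Real.exp ((∑ l, p.2 l ^ 2) / 2) * kk r p.2 p.1)) := by
  have : IsProbabilityMeasure (μ.map X) := Measure.isProbabilityMeasure_map hX.aemeasurable
  refine Measure.ext_of_lintegral _ fun F hF => ?_
  have hjoint := (indepFun_iff_map_prod_eq_prod_map_map hX.aemeasurable hN.aemeasurable).1 hXN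
  have hT : Measurable (fun p : (Fin L → ℝ) × (Fin L → ℝ) => (p.1, fun l => r * p.1 l + p.2 l)) := by
    fun_prop
  have hFT : Measurable (fun p : (Fin L → ℝ) × (Fin L → ℝ) =>
      F (p.1, fun l => r * p.1 l + p.2 l)) := hF.comp hT
  rw [lintegral_map hF (hX.prodMk (YY_measurable hX hN r)),
    lintegral_withDensity_eq_lintegral_mul _ (dens_measurable r) hF]
  calc ∫⁻ ω, F (X ω, YY X N r ω) ∂μ
      = ∫⁻ p, F (p.1, fun l => r * p.1 l + p.2 l) ∂(μ.map fun ω => (X ω, N ω)) := by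
        rw [lintegral_map hFT (hX.prodMk hN)]; rfl
    _ = ∫⁻ x, ∫⁻ n, F (x, fun l => r * x l + n l) ∂(stdG L) ∂(μ.map X) := by
        rw [hjoint, hN_law, lintegral_prod _ hFT.aemeasurable]
    _ = ∫⁻ x, ∫⁻ y, ENNReal.ofReal (Real.exp ((∑ l, y l ^ 2) / 2) * kk r y x) * F (x, y)
          ∂(stdG L) ∂(μ.map X) := by
        refine lintegral_congr fun x => ?_
        have hs : Measurable (fun (n : Fin L → ℝ) l => r * x l + n l) := by fun_prop
        have h := lintegral_map (μ := stdG L) (f := fun y => F (x, y)) (by fun_prop) hs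
        rw [← h, stdG_shift (fun l => r * x l),
          lintegral_withDensity_eq_lintegral_mul _ (by fun_prop) (by fun_prop)]
        simp only [Pi.mul_apply, exp_kk]
    _ = _ := by
        rw [lintegral_prod _ ((dens_measurable r).mul hF).aemeasurable]
        rfl

lemma marg_law (hX : Measurable X) (hN : Measurable N) (hXN : IndepFun X N μ)
    (hN_law : μ.map N = stdG L) (r : ℝ) :
    μ.map (YY X N r) = (stdG L).withDensity
      (fun y => ENNReal.ofReal (Real.exp (hh (μ.map X) r y))) := by
  have : IsProbabilityMeasure (μ.map X) := Measure.isProbabilityMeasure_map hX.aemeasurable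
  refine Measure.ext_of_lintegral _ fun F hF => ?_
  have hhm := hh_measurable (μ.map X) r
  rw [lintegral_map hF (YY_measurable hX hN r),
    lintegral_withDensity_eq_lintegral_mul _ (by fun_prop) hF]
  calc ∫⁻ ω, F (YY X N r ω) ∂μ
      = ∫⁻ p, F p.2 ∂(μ.map fun ω => (X ω, YY X N r ω)) := by
        rw [lintegral_map (by fun_prop) (hX.prodMk (YY_measurable hX hN r))]
    _ = ∫⁻ y, ∫⁻ x, ENNReal.ofReal (Real.exp ((∑ l, y l ^ 2) / 2) * kk r y x) * F y
          ∂(μ.map X) ∂(stdG L) := by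
        rw [joint_law hX hN hXN hN_law,
          lintegral_withDensity_eq_lintegral_mul _ (dens_measurable r) (by fun_prop),
          lintegral_prod_symm _ ((dens_measurable r).mul (by fun_prop)).aemeasurable]
        rfl
    _ = _ := by
        refine lintegral_congr fun y => ?_
        have hk := kk_measurable r y
        rw [lintegral_mul_const _ (by fun_prop)]
        simp only [Pi.mul_apply]
        congr 1
        rw [exp_hh, KK, ← integral_const_mul,
          ofReal_integral_eq_lintegral_ofReal ((kk_integrable _ r y).const_mul _)]
        exact ae_of_all _ fun x => mul_nonneg (Real.exp_pos _).le (kk_pos _ _ _).le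

end Law

section Main
variable {L : ℕ} {Ω : Type*} [MeasurableSpace Ω] {μ : Measure Ω} [IsProbabilityMeasure μ]
    {X N : Ω → Fin L → ℝ}

lemma memLp_noise (hN : Measurable N) (hN_law : μ.map N = stdG L) (l : Fin L) :
    MemLp (fun ω => N ω l) 2 μ := by
  have h1 : MemLp (fun y : Fin L → ℝ => y l) 2 (stdG L) :=
    (memLp_id_gaussianReal (μ := 0) (v := 1) 2).comp_measurePreserving
      (measurePreserving_eval (fun _ : Fin L => gaussianReal 0 1) l)
  rw [← hN_law] at h1
  exact h1.comp_of_map hN.aemeasurable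

lemma memLp_input (hX : Measurable X) (hX2 : Integrable (fun ω => ∑ l, X ω l ^ 2) μ) (l : Fin L) :
    MemLp (fun ω => X ω l) 2 μ := by
  have hm : Measurable fun ω => X ω l := by fun_prop
  rw [memLp_two_iff_integrable_sq hm.aestronglyMeasurable]
  refine hX2.mono' (hm.pow_const 2).aestronglyMeasurable (ae_of_all _ fun ω => ?_)
  rw [Real.norm_eq_abs, abs_of_nonneg (sq_nonneg _)]
  exact Finset.single_le_sum (f := fun l => X ω l ^ 2) (fun _ _ => sq_nonneg _) (Finset.mem_univ l)

lemma memLp_law (hX : Measurable X) (hX2 : ∀ l, MemLp (fun ω => X ω l) 2 μ) (l : Fin L) :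
    MemLp (fun x : Fin L → ℝ => x l) 2 (μ.map X) :=
  (memLp_map_measure_iff (measurable_pi_apply l).aestronglyMeasurable hX.aemeasurable).2 (hX2 l)

lemma memLp_YY (hX2 : ∀ l, MemLp (fun ω => X ω l) 2 μ) (hN2 : ∀ l, MemLp (fun ω => N ω l) 2 μ)
    (r : ℝ) (l : Fin L) : MemLp (fun ω => YY X N r ω l) 2 μ :=
  ((hX2 l).const_mul r).add (hN2 l)

/-- All standing assumptions. -/
structure Setup (μ : Measure Ω) (X N : Ω → Fin L → ℝ) : Prop where
  hX : Measurable X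
  hN : Measurable N
  hXN : IndepFun X N μ
  hlaw : μ.map N = stdG L
  hX2 : ∀ l, MemLp (fun ω => X ω l) 2 μ
  hN2 : ∀ l, MemLp (fun ω => N ω l) 2 μ
  hP2 : ∀ l, MemLp (fun x : Fin L → ℝ => x l) 2 (μ.map X)
  hP1 : ∀ l, Integrable (fun x : Fin L → ℝ => x l) (μ.map X)
  prob : IsProbabilityMeasure (μ.map X)

lemma hh_integrable (S : Setup μ X N) (r' r : ℝ) :
    Integrable (fun ω => hh (μ.map X) r' (YY X N r ω)) μ := by
  have := S.prob
  have hY := YY_measurable S.hX S.hN r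
  have h1 : Integrable (fun ω => ∑ l, YY X N r ω l ^ 2 + r' ^ 2 * ∑ l, ∫ x, x l ^ 2 ∂(μ.map X)) μ :=
    (integrable_finsetSum _ fun l _ => (memLp_YY S.hX2 S.hN2 r l).integrable_sq).add
      (integrable_const _)
  exact h1.mono' ((hh_measurable (μ.map X) r').comp hY).aestronglyMeasurable
    (ae_of_all _ fun ω => hh_bound S.hP2 r' _)

lemma integrable_exp_hh (S : Setup μ X N) (r : ℝ) :
    Integrable (fun y => Real.exp (hh (μ.map X) r y)) (stdG L) ∧
    ∫ y, Real.exp (hh (μ.map X) r y) ∂(stdG L) = 1 := by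
  have := S.prob
  have hm := hh_measurable (μ.map X) r
  have h1 : ∫⁻ y, ENNReal.ofReal (Real.exp (hh (μ.map X) r y)) ∂(stdG L) = 1 := by
    have := marg_law S.hX S.hN S.hXN S.hlaw r
    have hp : IsProbabilityMeasure (μ.map (YY X N r)) :=
      Measure.isProbabilityMeasure_map (YY_measurable S.hX S.hN r).aemeasurable
    have h := hp.measure_univ
    rw [this, withDensity_apply _ MeasurableSet.univ, Measure.restrict_univ] at h
    exact h
  have hi : Integrable (fun y => Real.exp (hh (μ.map X) r y)) (stdG L) := by
    refine ⟨(by fun_prop : Measurable _).aestronglyMeasurable, ?_⟩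
    rw [hasFiniteIntegral_iff_ofReal (ae_of_all _ fun y => (Real.exp_pos _).le), h1]
    simp
  refine ⟨hi, ?_⟩
  rw [integral_eq_lintegral_of_nonneg_ae (ae_of_all _ fun y => (Real.exp_pos _).le)
    hi.aestronglyMeasurable, h1]
  simp

lemma gibbs (S : Setup μ X N) (r' r : ℝ) :
    ∫ ω, hh (μ.map X) r' (YY X N r ω) ∂μ ≤ ∫ ω, hh (μ.map X) r (YY X N r ω) ∂μ := by
  have := S.prob
  have hY := YY_measurable S.hX S.hN r
  have hm := hh_measurable (μ.map X) r
  have hm' := hh_measurable (μ.map X) r'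
  set u : (Fin L → ℝ) → ℝ := fun y => Real.exp (hh (μ.map X) r' y - hh (μ.map X) r y) with hu
  have hum : Measurable u := by simp only [hu]; fun_prop
  have hmul : ∀ y, (ENNReal.ofReal (Real.exp (hh (μ.map X) r y))).toReal • u y
      = Real.exp (hh (μ.map X) r' y) := by
    intro y
    rw [ENNReal.toReal_ofReal (Real.exp_pos _).le, smul_eq_mul, hu]
    simp only
    rw [← Real.exp_add]; congr 1; ring
  have hdm : Measurable fun y => ENNReal.ofReal (Real.exp (hh (μ.map X) r y)) := by fun_prop
  have hui : Integrable u (μ.map (YY X N r)) := by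
    rw [marg_law S.hX S.hN S.hXN S.hlaw r,
      integrable_withDensity_iff_integrable_smul' hdm (ae_of_all _ fun y => ENNReal.ofReal_lt_top)]
    simp_rw [hmul]
    exact (integrable_exp_hh S r').1
  have hu1 : ∫ y, u y ∂(μ.map (YY X N r)) = 1 := by
    rw [marg_law S.hX S.hN S.hXN S.hlaw r,
      integral_withDensity_eq_integral_toReal_smul hdm (ae_of_all _ fun y => ENNReal.ofReal_lt_top)]
    simp_rw [hmul]
    exact (integrable_exp_hh S r').2
  have hui' : Integrable (fun ω => u (YY X N r ω)) μ := hui.comp_measurable hY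
  have hu1' : ∫ ω, u (YY X N r ω) ∂μ = 1 := by
    rw [← hu1, integral_map hY.aemeasurable hum.aestronglyMeasurable]
  have h1 := hh_integrable S r' r
  have h2 := hh_integrable S r r
  have h3 := integral_mono (h1.sub h2) (hui'.sub (integrable_const (1:ℝ))) (fun ω => by
    have := Real.add_one_le_exp (hh (μ.map X) r' (YY X N r ω) - hh (μ.map X) r (YY X N r ω))
    simp only [Pi.sub_apply, hu]
    linarith)
  simp only [Pi.sub_apply] at h3
  rw [integral_sub h1 h2, integral_sub hui' (integrable_const _), hu1'] at h3
  simp at h3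
  linarith

lemma hh_zero (P : Measure (Fin L → ℝ)) [IsProbabilityMeasure P] (y : Fin L → ℝ) : hh P 0 y = 0 := by
  simp [hh, KK, kk]
  ring

lemma klDiv_eq (S : Setup μ X N) (r : ℝ) :
    (klDiv (μ.map (YY X N r)) (μ.map N)).toReal = ∫ ω, hh (μ.map X) r (YY X N r ω) ∂μ := by
  have := S.prob
  have hY := YY_measurable S.hX S.hN r
  have hm := hh_measurable (μ.map X) r
  have hlaw := marg_law S.hX S.hN S.hXN S.hlaw r
  have hac : μ.map (YY X N r) ≪ stdG L := by
    rw [hlaw]; exact withDensity_absolutelyContinuous _ _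
  have hrn : (μ.map (YY X N r)).rnDeriv (stdG L) =ᵐ[stdG L]
      fun y => ENNReal.ofReal (Real.exp (hh (μ.map X) r y)) := by
    rw [hlaw]; exact Measure.rnDeriv_withDensity _ (by fun_prop)
  have hllr : llr (μ.map (YY X N r)) (stdG L) =ᵐ[μ.map (YY X N r)] hh (μ.map X) r := by
    filter_upwards [hac.ae_le hrn] with y hy
    rw [llr, hy, ENNReal.toReal_ofReal (Real.exp_pos _).le, Real.log_exp]
  have hint : Integrable (hh (μ.map X) r) (μ.map (YY X N r)) :=
    (integrable_map_measure hm.aestronglyMeasurable hY.aemeasurable).2 (hh_integrable S r r)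
  have h0 : 0 ≤ ∫ ω, hh (μ.map X) r (YY X N r ω) ∂μ := by
    have := gibbs S 0 r
    simpa [hh_zero] using this
  rw [S.hlaw, klDiv, if_pos ⟨hac, hint.congr hllr.symm⟩, integral_congr_ae hllr,
    integral_map hY.aemeasurable hm.aestronglyMeasurable, ENNReal.toReal_ofReal h0]

lemma mvt_aux (f f' : ℝ → ℝ) (hf : ∀ t, HasDerivAt f (f' t) t) (a₀ a : ℝ) :
    ∃ ξ, |ξ - a₀| ≤ |a - a₀| ∧ f a - f a₀ = (a - a₀) * f' ξ := by
  have hc : Continuous f := continuous_iff_continuousAt.2 fun t => (hf t).continuousAt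
  rcases lt_trichotomy a₀ a with h | h | h
  · obtain ⟨ξ, hξ, he⟩ := exists_hasDerivAt_eq_slope f f' h hc.continuousOn fun t _ => hf t
    refine ⟨ξ, ?_, ?_⟩
    · rw [abs_of_pos (by linarith [hξ.1]), abs_of_pos (by linarith)]; linarith [hξ.2]
    · have : a - a₀ ≠ 0 := by linarith
      rw [he]; field_simp
  · exact ⟨a, le_rfl, by simp [h]⟩
  · obtain ⟨ξ, hξ, he⟩ := exists_hasDerivAt_eq_slope f f' h hc.continuousOn fun t _ => hf t
    refine ⟨ξ, ?_, ?_⟩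
    · rw [abs_of_neg (by linarith [hξ.2]), abs_of_neg (by linarith)]; linarith [hξ.1]
    · have : a₀ - a ≠ 0 := by linarith
      rw [he]; field_simp; ring

/-- Directional derivative of the log-density. -/
def GG (P : Measure (Fin L → ℝ)) (x n : Fin L → ℝ) (r t : ℝ) : ℝ :=
  ∑ l, x l * (r * gg P l r (fun l => t * x l + n l))

lemma GG_continuous {P : Measure (Fin L → ℝ)} [IsProbabilityMeasure P]
    (hP : ∀ l, Integrable (fun x : Fin L → ℝ => x l) P) (x n : Fin L → ℝ) :
    Continuous fun p : ℝ × ℝ => GG P x n p.1 p.2 := by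
  have h : Continuous fun p : ℝ × ℝ => ((p.1, fun l => p.2 * x l + n l) : ℝ × (Fin L → ℝ)) := by
    fun_prop
  have hc : ∀ l, Continuous fun p : ℝ × ℝ => gg P l p.1 (fun l => p.2 * x l + n l) := by
    intro l
    have := Continuous.comp (g := fun p : ℝ × (Fin L → ℝ) => gg P l p.1 p.2)
      (f := fun p : ℝ × ℝ => ((p.1, fun l => p.2 * x l + n l) : ℝ × (Fin L → ℝ)))
      (gg_continuous hP l) h
    simpa only [Function.comp_def] using this
  unfold GG
  refine continuous_finsetSum _ fun l _ => ?_
  have := hc l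
  fun_prop

lemma GG_bound {P : Measure (Fin L → ℝ)} [IsProbabilityMeasure P]
    (hP : ∀ l, Integrable (fun x : Fin L → ℝ => x l) P) (x n : Fin L → ℝ) (r t R : ℝ)
    (hr : |r| ≤ R) (ht : |t| ≤ R) :
    |GG P x n r t| ≤ (∑ l, |x l|) * (2 * (R * (∑ l, |x l|) + ∑ l, |n l|) +
      R * ∑ j, ∫ x, |x j| ∂P) := by
  unfold GG
  rw [Finset.sum_mul]
  refine (Finset.abs_sum_le_sum_abs _ _).trans (Finset.sum_le_sum fun l _ => ?_)
  rw [abs_mul]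
  refine mul_le_mul_of_nonneg_left ((gg_bound hP l r _).trans ?_) (abs_nonneg _)
  have h0 : 0 ≤ ∑ j, ∫ x, |x j| ∂P :=
    Finset.sum_nonneg fun j _ => integral_nonneg fun x => abs_nonneg _
  refine add_le_add (mul_le_mul_of_nonneg_left ?_ (by norm_num)) (mul_le_mul_of_nonneg_right hr h0)
  rw [Finset.mul_sum, ← Finset.sum_add_distrib]
  refine Finset.sum_le_sum fun j _ => ?_
  refine (abs_add_le _ _).trans (add_le_add ?_ le_rfl)
  rw [abs_mul]
  exact mul_le_mul_of_nonneg_right ht (abs_nonneg _)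

lemma slope_tendsto (S : Setup μ X N) (a₀ : ℝ) (ρ : ℝ → ℝ) (hρ : Tendsto ρ (𝓝 a₀) (𝓝 a₀)) :
    Tendsto (fun a => ∫ ω, (a - a₀)⁻¹ * (hh (μ.map X) (ρ a) (YY X N a ω)
        - hh (μ.map X) (ρ a) (YY X N a₀ ω)) ∂μ) (𝓝[≠] a₀)
      (𝓝 (∫ ω, GG (μ.map X) (X ω) (N ω) a₀ a₀ ∂μ)) := by
  have := S.prob
  set R := |a₀| + 1 with hR
  have hmvt : ∀ a ω, ∃ ξ, |ξ - a₀| ≤ |a - a₀| ∧ (hh (μ.map X) (ρ a) (YY X N a ω)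
        - hh (μ.map X) (ρ a) (YY X N a₀ ω)) = (a - a₀) * GG (μ.map X) (X ω) (N ω) (ρ a) ξ :=
    fun a ω => mvt_aux (fun t => hh (μ.map X) (ρ a) (YY X N t ω)) _
      (fun t => hh_hasDerivAt S.hP1 (ρ a) (X ω) (N ω) t) a₀ a
  choose ξ hξ1 hξ2 using hmvt
  have heq : ∀ a, a ≠ a₀ → ∀ ω, (a - a₀)⁻¹ * (hh (μ.map X) (ρ a) (YY X N a ω)
        - hh (μ.map X) (ρ a) (YY X N a₀ ω)) = GG (μ.map X) (X ω) (N ω) (ρ a) (ξ a ω) := by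
    intro a ha ω
    rw [hξ2, ← mul_assoc, inv_mul_cancel₀ (sub_ne_zero.2 ha), one_mul]
  have hne : ∀ᶠ a in 𝓝[≠] a₀, a ≠ a₀ := eventually_mem_nhdsWithin
  have hXS : MemLp (fun ω => ∑ l, |X ω l|) 2 μ := memLp_finsetSum _ fun l _ => (S.hX2 l).abs
  have hNS : MemLp (fun ω => ∑ l, |N ω l|) 2 μ := memLp_finsetSum _ fun l _ => (S.hN2 l).abs
  refine tendsto_integral_filter_of_dominated_convergence
    (fun ω => (∑ l, |X ω l|) * (2 * (R * (∑ l, |X ω l|) + ∑ l, |N ω l|) +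
      R * ∑ j, ∫ x, |x j| ∂(μ.map X))) ?_ ?_ ?_ ?_
  · refine Eventually.of_forall fun a => ?_
    exact (((hh_integrable S (ρ a) a).sub (hh_integrable S (ρ a) a₀)).const_mul _).aestronglyMeasurable
  · have h1 : ∀ᶠ a in 𝓝[≠] a₀, |a - a₀| < 1 :=
      nhdsWithin_le_nhds (Metric.ball_mem_nhds a₀ one_pos)
    have h2 : ∀ᶠ a in 𝓝[≠] a₀, |ρ a - a₀| < 1 :=
      nhdsWithin_le_nhds (hρ (Metric.ball_mem_nhds a₀ one_pos))
    filter_upwards [hne, h1, h2] with a ha h1 h2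
    refine ae_of_all _ fun ω => ?_
    rw [heq a ha, Real.norm_eq_abs]
    refine GG_bound S.hP1 _ _ _ _ _ ?_ ?_
    · have := abs_add_le (ρ a - a₀) a₀
      simp only [sub_add_cancel] at this; linarith
    · have := abs_add_le (ξ a ω - a₀) a₀
      simp only [sub_add_cancel] at this; linarith [hξ1 a ω]
  · exact hXS.integrable_mul ((((hXS.const_mul R).add hNS).const_mul 2).add (memLp_const _))
  · refine ae_of_all _ fun ω => ?_
    have hξt : Tendsto (fun a => ξ a ω) (𝓝[≠] a₀) (𝓝 a₀) := by
      rw [tendsto_iff_dist_tendsto_zero]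
      refine squeeze_zero (fun _ => dist_nonneg) (fun a => ?_) 
        ((tendsto_iff_dist_tendsto_zero.1 (tendsto_id (x := 𝓝 a₀))).mono_left nhdsWithin_le_nhds)
      exact hξ1 a ω
    have h3 := ((GG_continuous S.hP1 (X ω) (N ω)).tendsto (a₀, a₀)).comp
      ((hρ.mono_left nhdsWithin_le_nhds).prodMk_nhds hξt)
    refine h3.congr' ?_
    filter_upwards [hne] with a ha
    rw [heq a ha]; rfl

lemma FF_hasDerivAt (S : Setup μ X N) (a₀ : ℝ) :
    HasDerivAt (fun a => ∫ ω, hh (μ.map X) a (YY X N a ω) ∂μ)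
      (∫ ω, GG (μ.map X) (X ω) (N ω) a₀ a₀ ∂μ) a₀ := by
  rw [hasDerivAt_iff_tendsto_slope]
  have h1 := slope_tendsto S a₀ (fun _ => a₀) tendsto_const_nhds
  have h2 := slope_tendsto S a₀ (fun a => a) tendsto_id
  have hmin := h1.min h2
  have hmax := h1.max h2
  rw [min_self] at hmin
  rw [max_self] at hmax
  have key : ∀ a, slope (fun a => ∫ ω, hh (μ.map X) a (YY X N a ω) ∂μ) a₀ a =
      (a - a₀)⁻¹ * (∫ ω, hh (μ.map X) a (YY X N a ω) ∂μ - ∫ ω, hh (μ.map X) a₀ (YY X N a₀ ω) ∂μ) :=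
    fun a => by rw [slope_def_field]; ring
  have e : ∀ ρ a, ∫ ω, (a - a₀)⁻¹ * (hh (μ.map X) ρ (YY X N a ω)
        - hh (μ.map X) ρ (YY X N a₀ ω)) ∂μ = (a - a₀)⁻¹ * (∫ ω, hh (μ.map X) ρ (YY X N a ω) ∂μ
        - ∫ ω, hh (μ.map X) ρ (YY X N a₀ ω) ∂μ) := by
    intro ρ a
    rw [integral_const_mul, integral_sub (hh_integrable S _ _) (hh_integrable S _ _)]
  refine tendsto_of_tendsto_of_tendsto_of_le_of_le hmin hmax (fun a => ?_) (fun a => ?_)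
  all_goals
    simp only [key, e]
    have g1 := gibbs S a₀ a
    have g2 := gibbs S a a₀
    rcases le_total 0 (a - a₀)⁻¹ with h | h
  · exact (min_le_left _ _).trans (mul_le_mul_of_nonneg_left (by linarith) h)
  · exact (min_le_right _ _).trans (mul_le_mul_of_nonpos_left (by linarith) h)
  · exact (mul_le_mul_of_nonneg_left (by linarith) h).trans (le_max_right _ _)
  · exact (mul_le_mul_of_nonpos_left (by linarith) h).trans (le_max_left _ _)

lemma gg_memLp (S : Setup μ X N) {r : ℝ} (hr : r ≠ 0) (l : Fin L) :
    MemLp (fun ω => gg (μ.map X) l r (YY X N r ω)) 2 μ := by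
  have := S.prob
  have hY := YY_measurable S.hX S.hN r
  have hYS : MemLp (fun ω => ∑ l, |YY X N r ω l|) 2 μ :=
    memLp_finsetSum _ fun l _ => (memLp_YY S.hX2 S.hN2 r l).abs
  have hB : MemLp (fun ω => |r|⁻¹ * (2 * ∑ j, |YY X N r ω j| + |r| * ∑ j, ∫ x, |x j| ∂(μ.map X))) 2 μ :=
    ((hYS.const_mul 2).add (memLp_const _)).const_mul _
  refine hB.mono' ((gg_measurable S.hP1 l r).comp hY).aestronglyMeasurable (ae_of_all _ fun ω => ?_)
  have h := gg_bound S.hP1 l r (YY X N r ω)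
  rw [abs_mul] at h
  rw [Real.norm_eq_abs, le_inv_mul_iff₀ (abs_pos.2 hr)]
  exact h

lemma condExp_eq (S : Setup μ X N) {r : ℝ} (hr : r ≠ 0) (l : Fin L) :
    (fun ω => gg (μ.map X) l r (YY X N r ω)) =ᵐ[μ]
      μ[fun ω => X ω l | MeasurableSpace.comap (YY X N r) inferInstance] := by
  have := S.prob
  have hY := YY_measurable S.hX S.hN r
  have hgm := gg_measurable S.hP1 l r
  have hhm := hh_measurable (μ.map X) r
  have hXi : Integrable (fun ω => X ω l) μ := (S.hX2 l).integrable (by norm_num)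
  have hgi : Integrable (fun ω => gg (μ.map X) l r (YY X N r ω)) μ :=
    (gg_memLp S hr l).integrable (by norm_num)
  refine ae_eq_condExp_of_forall_setIntegral_eq hY.comap_le hXi (fun s _ _ => hgi.integrableOn) ?_ ?_
  · rintro s ⟨B, hB, rfl⟩ -
    rw [← integral_indicator (hY hB), ← integral_indicator (hY hB)]
    have hXY : Measurable fun ω => (X ω, YY X N r ω) := S.hX.prodMk hY
    set F : (Fin L → ℝ) × (Fin L → ℝ) → ℝ := fun p => B.indicator (fun _ => (1:ℝ)) p.2 * p.1 l with hF
    have hind : Measurable (B.indicator (fun _ => (1:ℝ))) := measurable_const.indicator hB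
    have hFm : Measurable F := by simp only [hF]; fun_prop
    have hR : (fun ω => ((YY X N r) ⁻¹' B).indicator (fun ω => X ω l) ω)
        = fun ω => F (X ω, YY X N r ω) := by
      ext ω
      by_cases h : YY X N r ω ∈ B <;> simp [hF, Set.indicator, h]
    have hL : (fun ω => ((YY X N r) ⁻¹' B).indicator (fun ω => gg (μ.map X) l r (YY X N r ω)) ω)
        = fun ω => B.indicator (gg (μ.map X) l r) (YY X N r ω) := by
      ext ω
      by_cases h : YY X N r ω ∈ B <;> simp [Set.indicator, h]
    have hFi : Integrable F (μ.map fun ω => (X ω, YY X N r ω)) := by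
      rw [integrable_map_measure hFm.aestronglyMeasurable hXY.aemeasurable]
      change Integrable (fun ω => F (X ω, YY X N r ω)) μ
      rw [← hR]
      exact hXi.indicator (hY hB)
    rw [hR, hL]
    have hjoint := joint_law S.hX S.hN S.hXN S.hlaw r
    have hdm : Measurable fun y => ENNReal.ofReal (Real.exp (hh (μ.map X) r y)) := by fun_prop
    have hFi2 := hFi
    rw [hjoint, integrable_withDensity_iff_integrable_smul' (dens_measurable r)
      (ae_of_all _ fun y => ENNReal.ofReal_lt_top)] at hFi2
    rw [← integral_map (φ := fun ω => (X ω, YY X N r ω)) hXY.aemeasurable hFm.aestronglyMeasurable,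
      ← integral_map (φ := YY X N r) hY.aemeasurable (hgm.indicator hB).aestronglyMeasurable,
      hjoint, marg_law S.hX S.hN S.hXN S.hlaw r,
      integral_withDensity_eq_integral_toReal_smul hdm (ae_of_all _ fun y => ENNReal.ofReal_lt_top),
      integral_withDensity_eq_integral_toReal_smul (dens_measurable r)
        (ae_of_all _ fun y => ENNReal.ofReal_lt_top),
      integral_prod_symm _ hFi2]
    refine integral_congr_ae (ae_of_all _ fun y => ?_)
    simp only [smul_eq_mul, hF]
    have h1 : ∀ x : Fin L → ℝ, (ENNReal.ofReal (Real.exp ((∑ l, y l ^ 2) / 2) * kk r y x)).toReal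
        * (B.indicator (fun _ => (1:ℝ)) y * x l)
        = (Real.exp ((∑ l, y l ^ 2) / 2) * B.indicator (fun _ => (1:ℝ)) y) * (x l * kk r y x) := by
      intro x
      rw [ENNReal.toReal_ofReal (mul_nonneg (Real.exp_pos _).le (kk_pos _ _ _).le)]
      ring
    simp_rw [h1]
    rw [integral_const_mul, ENNReal.toReal_ofReal (Real.exp_pos _).le, exp_hh]
    have hK := (KK_pos (μ.map X) r y).ne'
    change _ = _ * BB (μ.map X) l r y
    by_cases h : y ∈ B
    · simp only [Set.indicator_of_mem h, gg]
      field_simp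
    · simp [Set.indicator_of_notMem h]
  · refine StronglyMeasurable.aestronglyMeasurable ?_
    exact (hgm.comp (comap_measurable (YY X N r))).stronglyMeasurable

lemma integral_GG (S : Setup μ X N) {r : ℝ} (hr : r ≠ 0) :
    ∫ ω, GG (μ.map X) (X ω) (N ω) r r ∂μ = r * ∫ ω, ∑ l,
      ((μ[fun ω' => X ω' l | MeasurableSpace.comap (YY X N r) inferInstance]) ω) ^ 2 ∂μ := by
  have := S.prob
  have hY := YY_measurable S.hX S.hN r
  have hg := fun l => gg_memLp S hr l
  have hc := fun l => condExp_eq S hr l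
  have hXi : ∀ l, Integrable (fun ω => X ω l) μ := fun l => (S.hX2 l).integrable (by norm_num)
  have hprod : ∀ l, Integrable (fun ω => gg (μ.map X) l r (YY X N r ω) * X ω l) μ :=
    fun l => (hg l).integrable_mul (S.hX2 l)
  have hA : ∀ l, ∫ ω, gg (μ.map X) l r (YY X N r ω) * X ω l ∂μ
      = ∫ ω, ((μ[fun ω' => X ω' l | MeasurableSpace.comap (YY X N r) inferInstance]) ω) ^ 2 ∂μ := by
    intro l
    have hsm : StronglyMeasurable[MeasurableSpace.comap (YY X N r) inferInstance]
        (fun ω => gg (μ.map X) l r (YY X N r ω)) :=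
      ((gg_measurable S.hP1 l r).comp (comap_measurable (YY X N r))).stronglyMeasurable
    have h1 := condExp_mul_of_stronglyMeasurable_left hsm (hprod l) (hXi l)
    have h2 := integral_condExp (μ := μ) (f := fun ω => gg (μ.map X) l r (YY X N r ω) * X ω l)
      hY.comap_le
    rw [← h2]
    refine integral_congr_ae ?_
    filter_upwards [h1, hc l] with ω e1 e2
    refine e1.trans ?_
    simp only [Pi.mul_apply]
    rw [e2]; ring
  have hsq : ∀ l, Integrable (fun ω =>
      ((μ[fun ω' => X ω' l | MeasurableSpace.comap (YY X N r) inferInstance]) ω) ^ 2) μ := by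
    intro l
    refine (hg l).integrable_sq.congr ?_
    filter_upwards [hc l] with ω e
    rw [e]
  rw [integral_finsetSum _ fun l _ => hsq l]
  simp_rw [← hA]
  rw [← integral_finsetSum _ fun l _ => hprod l, ← integral_const_mul]
  refine integral_congr_ae (ae_of_all _ fun ω => ?_)
  simp only [GG, Finset.mul_sum]
  refine Finset.sum_congr rfl fun l _ => ?_
  change _ = r * (gg (μ.map X) l r (fun l => r * X ω l + N ω l) * X ω l)
  ring

end Main

/-- **Derivative of the divergence from the noise distribution** (Theorem 6): for a random
vector `X` in `ℝ^L` with `E[‖X‖²] < ∞`,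
`d/dsnr D(P_{√snr·X+N} ‖ P_N) = (1/2) E[‖E[X | √snr·X + N]‖²]` for every `snr > 0`. -/
theorem hasDerivAt_klDiv_output_noise
    {Ω : Type*} [MeasurableSpace Ω] (μ : Measure Ω) [IsProbabilityMeasure μ]
    {L : ℕ} (X : Ω → Fin L → ℝ) (N : Ω → Fin L → ℝ)
    (hX : Measurable X) (hN : Measurable N)
    (hXN : IndepFun X N μ)
    (hN_law : μ.map N = Measure.pi fun _ : Fin L => gaussianReal 0 1)
    (hX2 : Integrable (fun ω => ∑ l, X ω l ^ 2) μ) :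
    ∀ snr ∈ Set.Ioi (0 : ℝ),
      HasDerivAt
        (fun s : ℝ =>
          (klDiv (μ.map fun ω l => Real.sqrt s * X ω l + N ω l) (μ.map N)).toReal)
        ((∫ ω, ∑ l,
            ((μ[fun ω' => X ω' l |
                MeasurableSpace.comap (fun ω' l' => Real.sqrt snr * X ω' l' + N ω' l')
                  inferInstance]) ω) ^ 2 ∂μ) / 2)
        snr := by
  intro snr hsnr
  have hsnr' : (0:ℝ) < snr := hsnr
  have hX2' := memLp_input hX hX2
  have hP2 := memLp_law hX hX2'
  have hprob : IsProbabilityMeasure (μ.map X) := Measure.isProbabilityMeasure_map hX.aemeasurable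
  have S : Setup μ X N := ⟨hX, hN, hXN, hN_law, hX2', memLp_noise hN hN_law, hP2,
    fun l => (hP2 l).integrable (by norm_num), hprob⟩
  have hr : 0 < Real.sqrt snr := Real.sqrt_pos.2 hsnr'
  have h1 := (FF_hasDerivAt S (Real.sqrt snr)).comp snr (Real.hasDerivAt_sqrt hsnr'.ne')
  rw [integral_GG S hr.ne'] at h1
  have h2 : (fun s : ℝ =>
      (klDiv (μ.map fun ω l => Real.sqrt s * X ω l + N ω l) (μ.map N)).toReal) =
      (fun a => ∫ ω, hh (μ.map X) a (YY X N a ω) ∂μ) ∘ Real.sqrt := by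
    ext s
    exact klDiv_eq S (Real.sqrt s)
  rw [h2]
  refine h1.congr_deriv ?_
  change Real.sqrt snr * (∫ ω, ∑ l, ((μ[fun ω' => X ω' l |
                MeasurableSpace.comap (fun ω' l' => Real.sqrt snr * X ω' l' + N ω' l')
                  inferInstance]) ω) ^ 2 ∂μ) * (1 / (2 * Real.sqrt snr)) = _
  field_simp
end
end

section
/- Let X — Z — Y be a Markov chain with Y = √snr · Z + N. Then for every snr > 0, d/dsnr I(X; Y) = (1/2) · E[(Z − E[Z | Y])^2] − (1/2) · E[(Z − E[Z | Y, X])^2]. -/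
open MeasureTheory ProbabilityTheory Real Filter
open scoped ENNReal NNReal Topology

noncomputable section

namespace IMMSE

/-- Standard Gaussian density. -/
def ph (t : ℝ) : ℝ := gaussianPDFReal 0 1 t

lemma ph_eq (t : ℝ) : ph t = (√(2 * π))⁻¹ * rexp (-t ^ 2 / 2) := by
  simp [ph, gaussianPDFReal]

lemma ph_pos (t : ℝ) : 0 < ph t := gaussianPDFReal_pos 0 1 t one_ne_zero

lemma c_pos : 0 < (√(2 * π))⁻¹ := by positivity

lemma c_le_one : (√(2 * π))⁻¹ ≤ 1 := by
  apply inv_le_one_of_one_le₀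
  rw [Real.one_le_sqrt]
  nlinarith [Real.pi_gt_three]

lemma ph_le_one (t : ℝ) : ph t ≤ 1 := by
  rw [ph_eq]
  have : rexp (-t ^ 2 / 2) ≤ 1 := by
    apply Real.exp_le_one_iff.2; nlinarith [sq_nonneg t]
  nlinarith [c_pos, c_le_one, Real.exp_pos (-t ^ 2 / 2)]

lemma sq_mul_ph_le (t : ℝ) : t ^ 2 * ph t ≤ 2 := by
  rw [ph_eq]
  have h1 : t ^ 2 / 2 + 1 ≤ rexp (t ^ 2 / 2) := Real.add_one_le_exp _
  have h2 : rexp (-t ^ 2 / 2) * rexp (t ^ 2 / 2) = 1 := by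
    rw [← Real.exp_add]; ring_nf; simp
  have h3 := Real.exp_pos (-t ^ 2 / 2)
  have h4 : t ^ 2 * rexp (-t ^ 2 / 2) ≤ 2 := by nlinarith
  calc t ^ 2 * ((√(2 * π))⁻¹ * rexp (-t ^ 2 / 2))
      = (√(2 * π))⁻¹ * (t ^ 2 * rexp (-t ^ 2 / 2)) := by ring
    _ ≤ 1 * 2 := by
      apply mul_le_mul c_le_one h4 _ zero_le_one
      positivity
    _ = 2 := by ring

lemma abs_pow_mul_ph_le {k : ℕ} (hk : k ≤ 2) (t : ℝ) : |t ^ k * ph t| ≤ 3 := by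
  have h0 := ph_pos t
  have h1 := ph_le_one t
  have h2 := sq_mul_ph_le t
  rw [abs_mul, abs_of_pos h0, abs_pow]
  have h3 : |t| ^ k ≤ 1 + t ^ 2 := by
    interval_cases k
    · simp; positivity
    · nlinarith [sq_nonneg (|t| - 1), sq_abs t]
    · simp
  nlinarith

@[fun_prop]
lemma continuous_ph : Continuous ph := by
  have : ph = fun t => (√(2 * π))⁻¹ * rexp (-t ^ 2 / 2) := funext ph_eq
  rw [this]; fun_prop

@[fun_prop]
lemma measurable_ph : Measurable ph := continuous_ph.measurable

lemma hasDerivAt_ph (t : ℝ) : HasDerivAt ph (-(t * ph t)) t := by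
  have : ph = fun t => (√(2 * π))⁻¹ * rexp (-t ^ 2 / 2) := funext ph_eq
  have h : HasDerivAt (fun t : ℝ => -t ^ 2 / 2) (-t) t := by
    have := ((hasDerivAt_pow 2 t).neg.div_const 2)
    refine this.congr_deriv ?_
    simp; ring
  rw [this]
  refine (h.exp.const_mul _).congr_deriv ?_
  ring

lemma gaussian_eq : gaussianReal 0 1 = volume.withDensity (fun t => ENNReal.ofReal (ph t)) := by
  rw [gaussianReal_of_var_ne_zero 0 one_ne_zero]; rfl

variable {α : Type*} [MeasurableSpace α]

/-- Moments of the noise against the unnormalised posterior. -/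
def fm (κ : Kernel α ℝ) (k : ℕ) (s : ℝ) (x : α) (y : ℝ) : ℝ :=
  ∫ z, (y - √s * z) ^ k * ph (y - √s * z) ∂κ x

section fm
set_option linter.unusedSectionVars false
variable (κ : Kernel α ℝ) [IsMarkovKernel κ]

lemma integrable_fm {k : ℕ} (hk : k ≤ 2) (s : ℝ) (x : α) (y : ℝ) :
    Integrable (fun z => (y - √s * z) ^ k * ph (y - √s * z)) (κ x) := by
  refine Integrable.of_bound (C := 3) (by fun_prop) (ae_of_all _ fun z => ?_)
  exact abs_pow_mul_ph_le hk _

lemma integrable_ph (s : ℝ) (x : α) (y : ℝ) :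
    Integrable (fun z => ph (y - √s * z)) (κ x) := by
  simpa using integrable_fm κ (k := 0) (by norm_num) s x y

lemma fm_zero_eq (s : ℝ) (x : α) (y : ℝ) : fm κ 0 s x y = ∫ z, ph (y - √s * z) ∂κ x := by
  simp [fm]

lemma fm_zero_pos (s : ℝ) (x : α) (y : ℝ) : 0 < fm κ 0 s x y := by
  rw [fm_zero_eq, integral_pos_iff_support_of_nonneg (fun z => (ph_pos _).le)
    (integrable_ph κ s x y)]
  have : Function.support (fun z => ph (y - √s * z)) = Set.univ := by
    ext z; simp [(ph_pos _).ne']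
  rw [this]; simp

lemma fm_zero_le_one (s : ℝ) (x : α) (y : ℝ) : fm κ 0 s x y ≤ 1 := by
  rw [fm_zero_eq]
  calc ∫ z, ph (y - √s * z) ∂κ x ≤ ∫ z, (1 : ℝ) ∂κ x :=
        integral_mono (integrable_ph κ s x y) (integrable_const _) fun z => ph_le_one _
    _ = 1 := by simp

lemma fm_sq_le (s : ℝ) (x : α) (y : ℝ) :
    (fm κ 1 s x y / fm κ 0 s x y) ^ 2 ≤ fm κ 2 s x y / fm κ 0 s x y := by
  set m := fm κ 1 s x y / fm κ 0 s x y with hm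
  have h0 := fm_zero_pos κ s x y
  have h1 : fm κ 1 s x y = m * fm κ 0 s x y := by rw [hm]; field_simp
  have h : 0 ≤ ∫ z, ((y - √s * z) - m) ^ 2 * ph (y - √s * z) ∂κ x :=
    integral_nonneg fun z => mul_nonneg (sq_nonneg _) (ph_pos _).le
  have h' : ∫ z, ((y - √s * z) - m) ^ 2 * ph (y - √s * z) ∂κ x
      = fm κ 2 s x y - 2 * m * fm κ 1 s x y + m ^ 2 * fm κ 0 s x y := by
    unfold fm
    rw [← integral_const_mul, ← integral_const_mul, ← integral_sub, ← integral_add]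
    · congr 1; ext z; ring
    · exact (integrable_fm κ le_rfl s x y).sub
        ((integrable_fm κ (by norm_num) s x y).const_mul _)
    · exact (integrable_fm κ (by norm_num) s x y).const_mul _
    · exact integrable_fm κ le_rfl s x y
    · exact (integrable_fm κ (by norm_num) s x y).const_mul _
  rw [le_div_iff₀ h0]
  rw [h', h1] at h
  nlinarith

lemma measurable_fm (k : ℕ) (s : ℝ) : Measurable (fun p : α × ℝ => fm κ k s p.1 p.2) := by
  have : StronglyMeasurable (fun q : (α × ℝ) × ℝ =>
      (q.1.2 - √s * q.2) ^ k * ph (q.1.2 - √s * q.2)) := by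
    apply Measurable.stronglyMeasurable; fun_prop
  have h := StronglyMeasurable.integral_kernel_prod_right' (κ := κ.comap Prod.fst measurable_fst) this
  exact h.measurable

/-- Continuity along the path. -/
lemma continuous_fm {k : ℕ} (hk : k ≤ 2) (x : α) (z₀ n : ℝ) :
    Continuous (fun u : ℝ => fm κ k u x (√u * z₀ + n)) := by
  unfold fm
  refine continuous_of_dominated (bound := fun _ => 3) (fun u => by fun_prop)
    (fun u => ae_of_all _ fun z => abs_pow_mul_ph_le hk _) (integrable_const _)
    (ae_of_all _ fun z => ?_)
  fun_prop

/-- Derivative along the path. -/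
lemma hasDerivAt_fm (x : α) (z₀ n : ℝ) {s : ℝ} (hs : 0 < s) :
    HasDerivAt (fun u : ℝ => fm κ 0 u x (√u * z₀ + n))
      (-(1 / (2 * s)) * (fm κ 2 s x (√s * z₀ + n) - n * fm κ 1 s x (√s * z₀ + n))) s := by
  have key := (hasDerivAt_integral_of_dominated_loc_of_deriv_le (μ := κ x)
    (F := fun u z => ph (√u * z₀ + n - √u * z))
    (F' := fun u z => -(1 / (2 * u)) * ((√u * z₀ + n - √u * z) ^ 2 * ph (√u * z₀ + n - √u * z)
      - n * ((√u * z₀ + n - √u * z) ^ 1 * ph (√u * z₀ + n - √u * z))))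
    (x₀ := s) (s := Set.Ioi (s / 2)) (bound := fun _ => (1 / s) * (3 + |n| * 3))
    (Ioi_mem_nhds (by linarith)) (Eventually.of_forall fun u => by fun_prop)
    (integrable_ph κ s x _) (by fun_prop) (ae_of_all _ fun z u hu => ?_) (integrable_const _)
    (ae_of_all _ fun z u hu => ?_)).2
  · simp only [fm_zero_eq]
    refine key.congr_deriv ?_
    rw [integral_const_mul, integral_sub (integrable_fm κ le_rfl s x _)
      ((integrable_fm κ (by norm_num) s x _).const_mul _), integral_const_mul]
    rfl
  · have hu' : s / 2 < u := hu
    rw [norm_mul, norm_neg]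
    apply mul_le_mul
    · rw [Real.norm_of_nonneg (by apply div_nonneg <;> linarith)]
      apply one_div_le_one_div_of_le hs; linarith
    · refine (norm_sub_le _ _).trans (add_le_add (abs_pow_mul_ph_le le_rfl _) ?_)
      rw [norm_mul]
      exact mul_le_mul_of_nonneg_left (abs_pow_mul_ph_le (by norm_num) _) (norm_nonneg _)
    · positivity
    · positivity
  · have hu' : s / 2 < u := hu
    have hu0 : 0 < u := by linarith
    have h1 := Real.hasDerivAt_sqrt hu0.ne'
    have h2 : HasDerivAt (fun u : ℝ => √u * z₀ + n - √u * z)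
        (1 / (2 * √u) * z₀ - 1 / (2 * √u) * z) u :=
      ((h1.mul_const z₀).add_const n).sub (h1.mul_const z)
    refine ((hasDerivAt_ph _).comp u h2).congr_deriv ?_
    have hq : √u ^ 2 = u := Real.sq_sqrt hu0.le
    have hq0 : √u ≠ 0 := (Real.sqrt_pos.2 hu0).ne'
    generalize ph (√u * z₀ + n - √u * z) = P
    rw [← hq, Real.sqrt_sq (Real.sqrt_nonneg u)]
    field_simp
    ring

end fm
end IMMSE

namespace IMMSE

section laws
variable {Ω : Type*} [MeasurableSpace Ω] {μ : Measure Ω} [IsProbabilityMeasure μ]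
    {α : Type*} [MeasurableSpace α] {X : Ω → α} {Z N : Ω → ℝ}
    {κ : Kernel α ℝ} [IsMarkovKernel κ]

/-- Master formula. -/
lemma lintegral_law (hX : Measurable X) (hZ : Measurable Z) (hN : Measurable N)
    (hXZN : IndepFun (fun ω => (X ω, Z ω)) N μ) (hN_law : μ.map N = gaussianReal 0 1)
    (hκ : μ.map (fun ω => (X ω, Z ω)) = μ.map X ⊗ₘ κ) (s : ℝ)
    {F : α → ℝ → ℝ → ℝ≥0∞} (hF : Measurable (fun q : α × ℝ × ℝ => F q.1 q.2.1 q.2.2)) :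
    ∫⁻ ω, F (X ω) (Z ω) (√s * Z ω + N ω) ∂μ
      = ∫⁻ x, ∫⁻ y, ∫⁻ z, ENNReal.ofReal (ph (y - √s * z)) * F x z y ∂κ x ∂volume ∂(μ.map X) := by
  have : IsProbabilityMeasure (μ.map X) := Measure.isProbabilityMeasure_map hX.aemeasurable
  have hlaw := (indepFun_iff_map_prod_eq_prod_map_map (hX.prodMk hZ).aemeasurable
    hN.aemeasurable).1 hXZN
  rw [hN_law, hκ] at hlaw
  have hG : Measurable (fun q : (α × ℝ) × ℝ => F q.1.1 q.1.2 (√s * q.1.2 + q.2)) :=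
    hF.comp (f := fun q : (α × ℝ) × ℝ => (q.1.1, q.1.2, √s * q.1.2 + q.2)) (by fun_prop)
  have h1 : ∫⁻ ω, F (X ω) (Z ω) (√s * Z ω + N ω) ∂μ
      = ∫⁻ q, F q.1.1 q.1.2 (√s * q.1.2 + q.2) ∂(μ.map (fun ω => ((X ω, Z ω), N ω))) := by
    rw [lintegral_map hG (by fun_prop)]
  rw [h1, hlaw, lintegral_prod _ hG.aemeasurable]
  have h2 : ∀ a : α × ℝ, ∫⁻ n, F a.1 a.2 (√s * a.2 + n) ∂(gaussianReal 0 1)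
      = ∫⁻ y, ENNReal.ofReal (ph (y - √s * a.2)) * F a.1 a.2 y := by
    intro a
    have hFa : Measurable (fun y => F a.1 a.2 y) :=
      hF.comp (f := fun y : ℝ => (a.1, a.2, y)) (by fun_prop)
    rw [gaussian_eq, lintegral_withDensity_eq_lintegral_mul _ (by fun_prop) (by fun_prop),
      ← lintegral_sub_right_eq_self _ (√s * a.2)]
    simp
  simp only [h2]
  have hH : Measurable (fun q : (α × ℝ) × ℝ =>
      ENNReal.ofReal (ph (q.2 - √s * q.1.2)) * F q.1.1 q.1.2 q.2) := by
    refine Measurable.mul (by fun_prop) ?_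
    exact hF.comp (f := fun q : (α × ℝ) × ℝ => (q.1.1, q.1.2, q.2)) (by fun_prop)
  rw [Measure.lintegral_compProd (hH.lintegral_prod_right')]
  refine lintegral_congr fun x => ?_
  rw [lintegral_lintegral_swap]
  exact (hH.comp (g := fun q : (α × ℝ) × ℝ =>
      ENNReal.ofReal (ph (q.2 - √s * q.1.2)) * F q.1.1 q.1.2 q.2)
      (f := fun p : ℝ × ℝ => ((x, p.1), p.2)) (by fun_prop)).aemeasurable

lemma lintegral_ph (s : ℝ) (x : α) (y : ℝ) :
    ∫⁻ z, ENNReal.ofReal (ph (y - √s * z)) ∂κ x = ENNReal.ofReal (fm κ 0 s x y) := by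
  rw [fm_zero_eq, ofReal_integral_eq_lintegral_ofReal (integrable_ph κ s x y)
    (ae_of_all _ fun z => (ph_pos _).le)]

lemma lintegral_law₂ (hX : Measurable X) (hZ : Measurable Z) (hN : Measurable N)
    (hXZN : IndepFun (fun ω => (X ω, Z ω)) N μ) (hN_law : μ.map N = gaussianReal 0 1)
    (hκ : μ.map (fun ω => (X ω, Z ω)) = μ.map X ⊗ₘ κ) (s : ℝ)
    {F : α → ℝ → ℝ≥0∞} (hF : Measurable (fun q : α × ℝ => F q.1 q.2)) :
    ∫⁻ ω, F (X ω) (√s * Z ω + N ω) ∂μ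
      = ∫⁻ x, ∫⁻ y, ENNReal.ofReal (fm κ 0 s x y) * F x y ∂volume ∂(μ.map X) := by
  rw [lintegral_law hX hZ hN hXZN hN_law hκ s (F := fun x _ y => F x y)
    (hF.comp (f := fun q : α × ℝ × ℝ => (q.1, q.2.2)) (by fun_prop))]
  refine lintegral_congr fun x => lintegral_congr fun y => ?_
  rw [lintegral_mul_const _ (by fun_prop), lintegral_ph]

/-- Posterior kernel. -/
def post (κ : Kernel α ℝ) [IsMarkovKernel κ] (s : ℝ) : Kernel (ℝ × α) ℝ :=
  Kernel.withDensity (κ.comap Prod.snd measurable_snd)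
    (fun a z => ENNReal.ofReal (ph (a.1 - √s * z) / fm κ 0 s a.2 a.1))

lemma measurable_post_dens (s : ℝ) : Measurable (Function.uncurry (fun (a : ℝ × α) (z : ℝ) =>
    ENNReal.ofReal (ph (a.1 - √s * z) / fm κ 0 s a.2 a.1))) := by
  have h := (measurable_fm κ 0 s).comp
    (f := fun q : (ℝ × α) × ℝ => (q.1.2, q.1.1)) (by fun_prop)
  refine Measurable.ennreal_ofReal (Measurable.div (by fun_prop) h)

lemma post_apply (s : ℝ) (a : ℝ × α) : post κ s a = (κ a.2).withDensity
    (fun z => ENNReal.ofReal (ph (a.1 - √s * z) / fm κ 0 s a.2 a.1)) := by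
  rw [post, Kernel.withDensity_apply _ (measurable_post_dens s)]; rfl

instance (s : ℝ) : IsMarkovKernel (post κ s) := by
  refine ⟨fun a => ⟨?_⟩⟩
  rw [post_apply, withDensity_apply _ MeasurableSet.univ, Measure.restrict_univ]
  have h0 := fm_zero_pos κ s a.2 a.1
  simp only [div_eq_mul_inv, ENNReal.ofReal_mul (ph_pos _).le]
  rw [lintegral_mul_const _ (by fun_prop), lintegral_ph, ← ENNReal.ofReal_mul h0.le,
    mul_inv_cancel₀ h0.ne', ENNReal.ofReal_one]

lemma integral_post (s : ℝ) (a : ℝ × α) (f : ℝ → ℝ) :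
    ∫ z, f z ∂(post κ s a) = (∫ z, f z * ph (a.1 - √s * z) ∂κ a.2) / fm κ 0 s a.2 a.1 := by
  have h0 := fm_zero_pos κ s a.2 a.1
  rw [post_apply, integral_withDensity_eq_integral_toReal_smul (by fun_prop)
    (ae_of_all _ fun z => ENNReal.ofReal_lt_top), ← integral_div]
  refine integral_congr_ae (ae_of_all _ fun z => ?_)
  simp only [smul_eq_mul]
  rw [ENNReal.toReal_ofReal (div_nonneg (ph_pos _).le h0.le)]
  ring

lemma law_post (hX : Measurable X) (hZ : Measurable Z) (hN : Measurable N)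
    (hXZN : IndepFun (fun ω => (X ω, Z ω)) N μ) (hN_law : μ.map N = gaussianReal 0 1)
    (hκ : μ.map (fun ω => (X ω, Z ω)) = μ.map X ⊗ₘ κ) (s : ℝ) :
    μ.map (fun ω => ((√s * Z ω + N ω, X ω), Z ω))
      = μ.map (fun ω => (√s * Z ω + N ω, X ω)) ⊗ₘ post κ s := by
  have : IsProbabilityMeasure (μ.map (fun ω => (√s * Z ω + N ω, X ω))) :=
    Measure.isProbabilityMeasure_map (by fun_prop)
  ext S hS
  have hT : Measurable (fun a : ℝ × α => post κ s a (Prod.mk a ⁻¹' S)) :=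
    Kernel.measurable_kernel_prodMk_left hS
  rw [Measure.compProd_apply hS, lintegral_map hT (by fun_prop),
    lintegral_law₂ hX hZ hN hXZN hN_law hκ s (F := fun x y => post κ s (y, x) (Prod.mk (y, x) ⁻¹' S))
      (hT.comp (f := fun q : α × ℝ => (q.2, q.1)) (by fun_prop)),
    ← lintegral_indicator_one hS, lintegral_map (measurable_one.indicator hS) (by fun_prop),
    lintegral_law hX hZ hN hXZN hN_law hκ s
      (F := fun x z y => S.indicator 1 ((y, x), z))
      ((measurable_one.indicator hS).comp (f := fun q : α × ℝ × ℝ => ((q.2.2, q.1), q.2.1))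
        (by fun_prop))]
  refine lintegral_congr fun x => lintegral_congr fun y => ?_
  have h0 := fm_zero_pos κ s x y
  have hS' : MeasurableSet (Prod.mk (y, x) ⁻¹' S) := measurable_prodMk_left hS
  rw [post_apply, withDensity_apply _ hS', ← lintegral_indicator hS',
    ← lintegral_const_mul _ (Measurable.indicator (by fun_prop) hS')]
  refine lintegral_congr fun z => ?_
  by_cases hz : ((y, x), z) ∈ S
  · simp only [Set.indicator, Set.mem_preimage, hz, if_true, Pi.one_apply, mul_one]
    rw [← ENNReal.ofReal_mul h0.le, mul_div_cancel₀ _ h0.ne']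
  · simp [Set.indicator, hz]

/-- Bayes formula for conditional expectations of powers of the noise. -/
lemma condExp_pow (hX : Measurable X) (hZ : Measurable Z) (hN : Measurable N)
    (hXZN : IndepFun (fun ω => (X ω, Z ω)) N μ) (hN_law : μ.map N = gaussianReal 0 1)
    (hκ : μ.map (fun ω => (X ω, Z ω)) = μ.map X ⊗ₘ κ) (s : ℝ) (k : ℕ)
    (hIntg : Integrable (fun ω => N ω ^ k) μ) :
    μ[fun ω => N ω ^ k | MeasurableSpace.comap (fun ω => (√s * Z ω + N ω, X ω)) inferInstance]
      =ᵐ[μ] fun ω => fm κ k s (X ω) (√s * Z ω + N ω) / fm κ 0 s (X ω) (√s * Z ω + N ω) := by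
  have hW : Measurable (fun ω => (√s * Z ω + N ω, X ω)) := by fun_prop
  have h1 := condDistrib_ae_eq_of_measure_eq_compProd_of_measurable hW hZ
    (law_post hX hZ hN hXZN hN_law hκ s)
  have h2 := condExp_prod_ae_eq_integral_condDistrib (μ := μ) (X := fun ω => (√s * Z ω + N ω, X ω))
    (Y := Z) (f := fun q : (ℝ × α) × ℝ => (q.1.1 - √s * q.2) ^ k) hW hZ.aemeasurable
    (Measurable.stronglyMeasurable (by fun_prop)) (by simpa using hIntg)
  have h3 := ae_of_ae_map hW.aemeasurable h1
  simp only [add_sub_cancel_left] at h2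
  filter_upwards [h2, h3] with ω h2 h3
  rw [h2, h3, integral_post]
  rfl

end laws
end IMMSE

namespace IMMSE

section deriv
set_option linter.unusedSectionVars false
variable {Ω : Type*} [MeasurableSpace Ω] {μ : Measure Ω} [IsProbabilityMeasure μ]
    {α : Type*} [MeasurableSpace α] {X : Ω → α} {Z N : Ω → ℝ}
    {κ : Kernel α ℝ} [IsMarkovKernel κ]

/-- Posterior mean of `N ^ k` along the path. -/
def pm (κ : Kernel α ℝ) (X : Ω → α) (Z N : Ω → ℝ) (k : ℕ) (s : ℝ) (ω : Ω) : ℝ :=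
  fm κ k s (X ω) (√s * Z ω + N ω) / fm κ 0 s (X ω) (√s * Z ω + N ω)

/-- The sigma-algebra generated by the output and `X`. -/
abbrev sg (X : Ω → α) (Z N : Ω → ℝ) (s : ℝ) : MeasurableSpace Ω :=
  MeasurableSpace.comap (fun ω => (√s * Z ω + N ω, X ω)) inferInstance

lemma sg_le (hX : Measurable X) (hZ : Measurable Z) (hN : Measurable N) (s : ℝ) :
    sg X Z N s ≤ (inferInstance : MeasurableSpace Ω) := by
  apply Measurable.comap_le; fun_prop

lemma memLp_N (hN : Measurable N) (hN_law : μ.map N = gaussianReal 0 1) : MemLp N 2 μ := by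
  have h := memLp_id_gaussianReal (μ := 0) (v := 1) 2
  rw [← hN_law] at h
  exact (memLp_map_measure_iff aestronglyMeasurable_id hN.aemeasurable).1 h

lemma integral_N_sq (hN : Measurable N) (hN_law : μ.map N = gaussianReal 0 1) :
    ∫ ω, N ω ^ 2 ∂μ = 1 := by
  have h1 : ∫ ω, N ω ^ 2 ∂μ = ∫ x, x ^ 2 ∂(gaussianReal 0 1) := by
    rw [← hN_law, integral_map hN.aemeasurable (by fun_prop)]
  have h2 := variance_fun_id_gaussianReal (μ := 0) (v := 1)
  rw [variance_eq_integral (by fun_prop)] at h2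
  simp at h2
  rw [h1, h2]

lemma continuous_pm {k : ℕ} (hk : k ≤ 2) (ω : Ω) : Continuous (fun s => pm κ X Z N k s ω) := by
  refine (continuous_fm κ hk _ _ _).div (continuous_fm κ (by norm_num) _ _ _) fun s => ?_
  exact (fm_zero_pos κ s _ _).ne'

lemma measurable_path_fm (hX : Measurable X) (hZ : Measurable Z) (hN : Measurable N) (k : ℕ) (s : ℝ) :
    Measurable (fun ω => fm κ k s (X ω) (√s * Z ω + N ω)) :=
  (measurable_fm κ k s).comp (f := fun ω => (X ω, √s * Z ω + N ω)) (by fun_prop)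

lemma measurable_pm (hX : Measurable X) (hZ : Measurable Z) (hN : Measurable N) (k : ℕ) (s : ℝ) :
    Measurable (pm κ X Z N k s) :=
  (measurable_path_fm hX hZ hN k s).div (measurable_path_fm hX hZ hN 0 s)

lemma pm_sq_le (s : ℝ) (ω : Ω) : pm κ X Z N 1 s ω ^ 2 ≤ pm κ X Z N 2 s ω :=
  fm_sq_le κ s _ _

lemma condExp_N (hX : Measurable X) (hZ : Measurable Z) (hN : Measurable N)
    (hXZN : IndepFun (fun ω => (X ω, Z ω)) N μ) (hN_law : μ.map N = gaussianReal 0 1)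
    (hκ : μ.map (fun ω => (X ω, Z ω)) = μ.map X ⊗ₘ κ) (s : ℝ) :
    μ[N | sg X Z N s] =ᵐ[μ] pm κ X Z N 1 s := by
  have hi : Integrable (fun ω => N ω ^ 1) μ := by
    simpa using (memLp_N hN hN_law).integrable (by norm_num)
  have h := condExp_pow hX hZ hN hXZN hN_law hκ s 1 hi
  simp only [pow_one] at h
  exact h

lemma condExp_N_sq (hX : Measurable X) (hZ : Measurable Z) (hN : Measurable N)
    (hXZN : IndepFun (fun ω => (X ω, Z ω)) N μ) (hN_law : μ.map N = gaussianReal 0 1)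
    (hκ : μ.map (fun ω => (X ω, Z ω)) = μ.map X ⊗ₘ κ) (s : ℝ) :
    μ[fun ω => N ω ^ 2 | sg X Z N s] =ᵐ[μ] pm κ X Z N 2 s :=
  condExp_pow hX hZ hN hXZN hN_law hκ s 2 (memLp_N hN hN_law).integrable_sq

lemma integrable_pm2 (hX : Measurable X) (hZ : Measurable Z) (hN : Measurable N)
    (hXZN : IndepFun (fun ω => (X ω, Z ω)) N μ) (hN_law : μ.map N = gaussianReal 0 1)
    (hκ : μ.map (fun ω => (X ω, Z ω)) = μ.map X ⊗ₘ κ) (s : ℝ) :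
    Integrable (pm κ X Z N 2 s) μ :=
  integrable_condExp.congr (condExp_N_sq hX hZ hN hXZN hN_law hκ s)

lemma integral_pm2 (hX : Measurable X) (hZ : Measurable Z) (hN : Measurable N)
    (hXZN : IndepFun (fun ω => (X ω, Z ω)) N μ) (hN_law : μ.map N = gaussianReal 0 1)
    (hκ : μ.map (fun ω => (X ω, Z ω)) = μ.map X ⊗ₘ κ) (s : ℝ) :
    ∫ ω, pm κ X Z N 2 s ω ∂μ = 1 := by
  rw [← integral_congr_ae (condExp_N_sq hX hZ hN hXZN hN_law hκ s),
    integral_condExp (sg_le hX hZ hN s), integral_N_sq hN hN_law]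

lemma memLp_pm1 (hX : Measurable X) (hZ : Measurable Z) (hN : Measurable N)
    (hXZN : IndepFun (fun ω => (X ω, Z ω)) N μ) (hN_law : μ.map N = gaussianReal 0 1)
    (hκ : μ.map (fun ω => (X ω, Z ω)) = μ.map X ⊗ₘ κ) (s : ℝ) :
    MemLp (pm κ X Z N 1 s) 2 μ := by
  have hm := (measurable_pm (κ := κ) hX hZ hN 1 s)
  rw [memLp_two_iff_integrable_sq hm.aestronglyMeasurable]
  refine (integrable_pm2 hX hZ hN hXZN hN_law hκ s).mono' (hm.pow_const 2).aestronglyMeasurable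
    (ae_of_all _ fun ω => ?_)
  rw [Real.norm_of_nonneg (sq_nonneg _)]
  exact pm_sq_le s ω

lemma integral_N_mul_pm1 (hX : Measurable X) (hZ : Measurable Z) (hN : Measurable N)
    (hXZN : IndepFun (fun ω => (X ω, Z ω)) N μ) (hN_law : μ.map N = gaussianReal 0 1)
    (hκ : μ.map (fun ω => (X ω, Z ω)) = μ.map X ⊗ₘ κ) (s : ℝ) :
    ∫ ω, N ω * pm κ X Z N 1 s ω ∂μ = ∫ ω, pm κ X Z N 1 s ω ^ 2 ∂μ := by
  have h1 := condExp_N hX hZ hN hXZN hN_law hκ s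
  have h2 := memLp_pm1 hX hZ hN hXZN hN_law hκ s
  have hNL := memLp_N hN hN_law
  have h3 : AEStronglyMeasurable[sg X Z N s] (pm κ X Z N 1 s) μ :=
    ⟨_, stronglyMeasurable_condExp, h1.symm⟩
  have h4 := condExp_mul_of_aestronglyMeasurable_right h3 (hNL.integrable_mul h2)
    (hNL.integrable (by norm_num))
  have h5 := integral_condExp (μ := μ) (f := N * pm κ X Z N 1 s) (sg_le hX hZ hN s)
  have h6 : ∫ ω, N ω * pm κ X Z N 1 s ω ∂μ = ∫ ω, (N * pm κ X Z N 1 s) ω ∂μ := rfl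
  rw [h6, ← h5]
  refine integral_congr_ae ?_
  filter_upwards [h4, h1] with ω h4 h1
  rw [h4, Pi.mul_apply, h1]; ring

lemma continuous_integral_pm1_sq (hX : Measurable X) (hZ : Measurable Z) (hN : Measurable N)
    (hXZN : IndepFun (fun ω => (X ω, Z ω)) N μ) (hN_law : μ.map N = gaussianReal 0 1)
    (hκ : μ.map (fun ω => (X ω, Z ω)) = μ.map X ⊗ₘ κ) :
    Continuous (fun s => ∫ ω, pm κ X Z N 1 s ω ^ 2 ∂μ) := by
  rw [continuous_iff_seqContinuous]
  intro v s hv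
  have hL := fun s => memLp_pm1 hX hZ hN hXZN hN_law hκ s
  have hui := ((memLp_N hN hN_law).integrable_sq.uniformIntegrable_condExp
    (fun n : ℕ => sg_le hX hZ hN (v n))).unifIntegrable
  have hui2 : UnifIntegrable (fun n ω => pm κ X Z N 1 (v n) ω ^ 2) 1 μ := by
    intro ε hε
    obtain ⟨δ, hδ, H⟩ := hui hε
    refine ⟨δ, hδ, fun n A hA hAδ => le_trans (eLpNorm_mono_ae ?_) (H n A hA hAδ)⟩
    filter_upwards [condExp_N_sq hX hZ hN hXZN hN_law hκ (v n)] with ω hω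
    by_cases hωA : ω ∈ A
    · simp only [Set.indicator_of_mem hωA, hω]
      rw [Real.norm_of_nonneg (sq_nonneg _)]
      exact (pm_sq_le _ ω).trans (le_abs_self _)
    · simp [hωA]
  have ht := tendsto_Lp_finite_of_tendsto_ae le_rfl ENNReal.one_ne_top
    (fun n => (hL (v n)).integrable_sq.aestronglyMeasurable)
    (memLp_one_iff_integrable.2 (hL s).integrable_sq) hui2 (ae_of_all _ fun ω =>
      (((continuous_pm (κ := κ) (X := X) (Z := Z) (N := N) (k := 1) (by norm_num) ω).pow 2).tendsto s).comp hv)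
  exact tendsto_integral_of_L1' _ (hL s).integrable_sq.aestronglyMeasurable
    (Eventually.of_forall fun n => (hL (v n)).integrable_sq) ht

/-- Pathwise derivative. -/
def dd (κ : Kernel α ℝ) (X : Ω → α) (Z N : Ω → ℝ) (s : ℝ) (ω : Ω) : ℝ :=
  -(1 / (2 * s)) * (pm κ X Z N 2 s ω - N ω * pm κ X Z N 1 s ω)

lemma hasDerivAt_log (ω : Ω) {s : ℝ} (hs : 0 < s) :
    HasDerivAt (fun u => Real.log (fm κ 0 u (X ω) (√u * Z ω + N ω))) (dd κ X Z N s ω) s := by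
  have h0 := (fm_zero_pos κ s (X ω) (√s * Z ω + N ω)).ne'
  refine ((hasDerivAt_fm κ (X ω) (Z ω) (N ω) hs).log h0).congr_deriv ?_
  unfold dd pm
  field_simp

lemma measurable_dd (hX : Measurable X) (hZ : Measurable Z) (hN : Measurable N) :
    Measurable (fun p : ℝ × Ω => dd κ X Z N p.1 p.2) := by
  have h1 := measurable_uncurry_of_continuous_of_measurable
    (fun ω => continuous_pm (κ := κ) (X := X) (Z := Z) (N := N) (k := 1) (by norm_num) ω)
    (fun s => measurable_pm hX hZ hN 1 s)
  have h2 := measurable_uncurry_of_continuous_of_measurable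
    (fun ω => continuous_pm (κ := κ) (X := X) (Z := Z) (N := N) (k := 2) (by norm_num) ω)
    (fun s => measurable_pm hX hZ hN 2 s)
  unfold dd
  refine Measurable.mul (by fun_prop) (h2.sub (Measurable.mul (by fun_prop) h1))

lemma integrable_dd (hX : Measurable X) (hZ : Measurable Z) (hN : Measurable N)
    (hXZN : IndepFun (fun ω => (X ω, Z ω)) N μ) (hN_law : μ.map N = gaussianReal 0 1)
    (hκ : μ.map (fun ω => (X ω, Z ω)) = μ.map X ⊗ₘ κ) (s : ℝ) :
    Integrable (dd κ X Z N s) μ :=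
  ((integrable_pm2 hX hZ hN hXZN hN_law hκ s).sub ((memLp_N hN hN_law).integrable_mul
    (memLp_pm1 hX hZ hN hXZN hN_law hκ s))).const_mul _

lemma integral_dd (hX : Measurable X) (hZ : Measurable Z) (hN : Measurable N)
    (hXZN : IndepFun (fun ω => (X ω, Z ω)) N μ) (hN_law : μ.map N = gaussianReal 0 1)
    (hκ : μ.map (fun ω => (X ω, Z ω)) = μ.map X ⊗ₘ κ) (s : ℝ) :
    ∫ ω, dd κ X Z N s ω ∂μ = -(1 / (2 * s)) * (1 - ∫ ω, pm κ X Z N 1 s ω ^ 2 ∂μ) := by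
  unfold dd
  have hNp : Integrable (fun ω => N ω * pm κ X Z N 1 s ω) μ :=
    (memLp_N hN hN_law).integrable_mul (memLp_pm1 hX hZ hN hXZN hN_law hκ s)
  rw [integral_const_mul, integral_sub (integrable_pm2 hX hZ hN hXZN hN_law hκ s) hNp,
    integral_pm2 hX hZ hN hXZN hN_law hκ s, integral_N_mul_pm1 hX hZ hN hXZN hN_law hκ s]

lemma integral_norm_dd_le (hX : Measurable X) (hZ : Measurable Z) (hN : Measurable N)
    (hXZN : IndepFun (fun ω => (X ω, Z ω)) N μ) (hN_law : μ.map N = gaussianReal 0 1)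
    (hκ : μ.map (fun ω => (X ω, Z ω)) = μ.map X ⊗ₘ κ) {a s : ℝ} (ha : 0 < a) (hs : a ≤ s) :
    ∫ ω, ‖dd κ X Z N s ω‖ ∂μ ≤ 1 / a := by
  have h2 := integrable_pm2 hX hZ hN hXZN hN_law hκ s
  have hN2 := (memLp_N hN hN_law).integrable_sq
  have hs0 : 0 < s := by linarith
  have hle : ∀ ω, ‖dd κ X Z N s ω‖ ≤ 1 / (2 * a) * (3 / 2 * pm κ X Z N 2 s ω + 1 / 2 * N ω ^ 2) := by
    intro ω
    unfold dd
    have hp := pm_sq_le (κ := κ) (X := X) (Z := Z) (N := N) s ω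
    rw [norm_mul, norm_neg]
    apply mul_le_mul
    · rw [Real.norm_of_nonneg (by positivity)]
      apply one_div_le_one_div_of_le <;> linarith
    · rw [Real.norm_eq_abs, abs_le]
      constructor <;> nlinarith [sq_nonneg (N ω - pm κ X Z N 1 s ω),
        sq_nonneg (N ω + pm κ X Z N 1 s ω), sq_nonneg (pm κ X Z N 1 s ω)]
    · positivity
    · positivity
  have hi := (h2.const_mul (3 / 2)).add (hN2.const_mul (1 / 2))
  calc ∫ ω, ‖dd κ X Z N s ω‖ ∂μ
      ≤ ∫ ω, 1 / (2 * a) * (3 / 2 * pm κ X Z N 2 s ω + 1 / 2 * N ω ^ 2) ∂μ :=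
        integral_mono (integrable_dd hX hZ hN hXZN hN_law hκ s).norm (hi.const_mul _) hle
    _ = 1 / a := by
      rw [integral_const_mul, integral_add (h2.const_mul _) (hN2.const_mul _),
        integral_const_mul, integral_const_mul, integral_pm2 hX hZ hN hXZN hN_law hκ s,
        integral_N_sq hN hN_law]
      field_simp
      norm_num

lemma entropy_sub (hX : Measurable X) (hZ : Measurable Z) (hN : Measurable N)
    (hXZN : IndepFun (fun ω => (X ω, Z ω)) N μ) (hN_law : μ.map N = gaussianReal 0 1)
    (hκ : μ.map (fun ω => (X ω, Z ω)) = μ.map X ⊗ₘ κ)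
    (hIntg : ∀ s : ℝ, Integrable (fun ω => Real.log (fm κ 0 s (X ω) (√s * Z ω + N ω))) μ)
    {a t : ℝ} (ha : 0 < a) (hat : a ≤ t) :
    ∫ ω, Real.log (fm κ 0 t (X ω) (√t * Z ω + N ω)) ∂μ
      - ∫ ω, Real.log (fm κ 0 a (X ω) (√a * Z ω + N ω)) ∂μ
      = ∫ s in a..t, -(1 / (2 * s)) * (1 - ∫ ω, pm κ X Z N 1 s ω ^ 2 ∂μ) := by
  rw [← integral_sub (hIntg t) (hIntg a)]
  have hpt : ∀ ω, Real.log (fm κ 0 t (X ω) (√t * Z ω + N ω))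
      - Real.log (fm κ 0 a (X ω) (√a * Z ω + N ω)) = ∫ s in Set.Ioc a t, dd κ X Z N s ω := by
    intro ω
    rw [← intervalIntegral.integral_of_le hat]
    refine (intervalIntegral.integral_eq_sub_of_hasDerivAt (f := fun u =>
      Real.log (fm κ 0 u (X ω) (√u * Z ω + N ω))) (fun s hs => ?_) ?_).symm
    · rw [Set.uIcc_of_le hat] at hs
      exact hasDerivAt_log ω (by linarith [hs.1])
    · refine ContinuousOn.intervalIntegrable ?_
      rw [Set.uIcc_of_le hat]
      unfold dd
      refine ContinuousOn.mul ?_ ?_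
      · refine (continuousOn_const.div (by fun_prop) fun s hs => ?_).neg
        have := hs.1
        have : 0 < s := by linarith
        positivity
      · exact ((continuous_pm le_rfl ω).sub (continuous_const.mul
          (continuous_pm (by norm_num) ω))).continuousOn
  simp_rw [hpt, ← integral_dd hX hZ hN hXZN hN_law hκ]
  rw [intervalIntegral.integral_of_le hat]
  rw [integral_integral_swap]
  have hm : Measurable (fun p : ℝ × Ω => dd κ X Z N p.1 p.2) := measurable_dd hX hZ hN
  have hI : Integrable (fun p : ℝ × Ω => dd κ X Z N p.1 p.2)
      ((volume.restrict (Set.Ioc a t)).prod μ) := by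
    rw [integrable_prod_iff hm.aestronglyMeasurable]
    refine ⟨ae_of_all _ fun s => integrable_dd hX hZ hN hXZN hN_law hκ s, ?_⟩
    refine Integrable.of_bound (C := 1 / a)
      (hm.norm.stronglyMeasurable.integral_prod_right').aestronglyMeasurable ?_
    refine (ae_restrict_iff' measurableSet_Ioc).2 (ae_of_all _ fun s hs => ?_)
    rw [Real.norm_of_nonneg (integral_nonneg fun ω => norm_nonneg _)]
    exact integral_norm_dd_le hX hZ hN hXZN hN_law hκ ha hs.1.le
  exact hI.swap

lemma hasDerivAt_entropy (hX : Measurable X) (hZ : Measurable Z) (hN : Measurable N)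
    (hXZN : IndepFun (fun ω => (X ω, Z ω)) N μ) (hN_law : μ.map N = gaussianReal 0 1)
    (hκ : μ.map (fun ω => (X ω, Z ω)) = μ.map X ⊗ₘ κ)
    (hIntg : ∀ s : ℝ, Integrable (fun ω => Real.log (fm κ 0 s (X ω) (√s * Z ω + N ω))) μ)
    {s : ℝ} (hs : 0 < s) :
    HasDerivAt (fun t => ∫ ω, Real.log (fm κ 0 t (X ω) (√t * Z ω + N ω)) ∂μ)
      (-(1 / (2 * s)) * (1 - ∫ ω, pm κ X Z N 1 s ω ^ 2 ∂μ)) s := by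
  set c : ℝ → ℝ := fun s => -(1 / (2 * s)) * (1 - ∫ ω, pm κ X Z N 1 s ω ^ 2 ∂μ) with hc
  have hcont : ContinuousOn c (Set.Ioi 0) := by
    refine ContinuousOn.mul ?_ (continuous_const.sub
      (continuous_integral_pm1_sq hX hZ hN hXZN hN_law hκ)).continuousOn
    refine (continuousOn_const.div (by fun_prop) fun s hs => ?_).neg
    have : 0 < s := hs
    positivity
  have h := intervalIntegral.integral_hasDerivAt_right (f := c) (a := s / 2) (b := s)
    (ContinuousOn.intervalIntegrable (hcont.mono fun u hu => by
      rw [Set.uIcc_of_le (by linarith)] at hu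
      have := hu.1
      show 0 < u
      linarith))
    (hcont.stronglyMeasurableAtFilter isOpen_Ioi s hs)
    (hcont.continuousAt (Ioi_mem_nhds hs))
  refine (h.add_const (∫ ω, Real.log (fm κ 0 (s / 2) (X ω) (√(s / 2) * Z ω + N ω)) ∂μ)).congr_of_eventuallyEq ?_
  filter_upwards [Ioi_mem_nhds (show s / 2 < s by linarith)] with t ht
  rw [← entropy_sub hX hZ hN hXZN hN_law hκ hIntg (by linarith) (le_of_lt ht)]
  ring

/-- MMSE in terms of the posterior mean of the noise. -/
lemma mmse_eq (hX : Measurable X) (hZ : Measurable Z) (hN : Measurable N)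
    (hXZN : IndepFun (fun ω => (X ω, Z ω)) N μ) (hN_law : μ.map N = gaussianReal 0 1)
    (hκ : μ.map (fun ω => (X ω, Z ω)) = μ.map X ⊗ₘ κ) (hZ1 : Integrable Z μ)
    {s : ℝ} (hs : 0 < s) :
    ∫ ω, (Z ω - (μ[Z | sg X Z N s]) ω) ^ 2 ∂μ = (1 / s) * (1 - ∫ ω, pm κ X Z N 1 s ω ^ 2 ∂μ) := by
  have h1 := condExp_N hX hZ hN hXZN hN_law hκ s
  have hLp := memLp_pm1 hX hZ hN hXZN hN_law hκ s
  have hNL := memLp_N hN hN_law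
  have hN1 : Integrable N μ := hNL.integrable (by norm_num)
  have hY : StronglyMeasurable[sg X Z N s] (√s • Z + N) := by
    have hW : Measurable[sg X Z N s] (fun ω => (√s * Z ω + N ω, X ω)) := comap_measurable _
    have : Measurable[sg X Z N s] (√s • Z + N) := measurable_fst.comp hW
    exact this.stronglyMeasurable
  have hYi : Integrable (√s • Z + N) μ := (hZ1.smul _).add hN1
  have h2 := condExp_of_stronglyMeasurable (sg_le hX hZ hN s) hY hYi
  have h3 := condExp_add (hZ1.smul √s) hN1 (sg X Z N s)
  have h4 := condExp_smul (μ := μ) √s Z (sg X Z N s)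
  have hq : √s ^ 2 = s := Real.sq_sqrt hs.le
  have hpt : ∀ᵐ ω ∂μ, (Z ω - (μ[Z | sg X Z N s]) ω) ^ 2
      = (1 / s) * (N ω ^ 2 - 2 * (N ω * pm κ X Z N 1 s ω) + pm κ X Z N 1 s ω ^ 2) := by
    filter_upwards [h1, h3, h4] with ω h1 h3 h4
    rw [h2] at h3
    simp only [Pi.add_apply, Pi.smul_apply, smul_eq_mul] at h3 h4
    rw [h1, h4] at h3
    have h5 : √s * (Z ω - (μ[Z | sg X Z N s]) ω) = -(N ω - pm κ X Z N 1 s ω) := by linarith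
    have h6 : s * (Z ω - (μ[Z | sg X Z N s]) ω) ^ 2 = (N ω - pm κ X Z N 1 s ω) ^ 2 := by
      rw [← neg_sq (N ω - _), ← h5, mul_pow, hq]
    field_simp
    linarith
  have hNp : Integrable (fun ω => N ω * pm κ X Z N 1 s ω) μ := hNL.integrable_mul hLp
  have hsub : Integrable (fun ω => N ω ^ 2 - 2 * (N ω * pm κ X Z N 1 s ω)) μ :=
    hNL.integrable_sq.sub (hNp.const_mul 2)
  rw [integral_congr_ae hpt, integral_const_mul, integral_add
    hsub hLp.integrable_sq,
    integral_sub hNL.integrable_sq (hNp.const_mul 2), integral_const_mul,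
    integral_N_mul_pm1 hX hZ hN hXZN hN_law hκ s, integral_N_sq hN hN_law]
  ring

lemma hasDerivAt_entropy_mmse (hX : Measurable X) (hZ : Measurable Z) (hN : Measurable N)
    (hXZN : IndepFun (fun ω => (X ω, Z ω)) N μ) (hN_law : μ.map N = gaussianReal 0 1)
    (hκ : μ.map (fun ω => (X ω, Z ω)) = μ.map X ⊗ₘ κ) (hZ1 : Integrable Z μ)
    (hIntg : ∀ s : ℝ, Integrable (fun ω => Real.log (fm κ 0 s (X ω) (√s * Z ω + N ω))) μ)
    {s : ℝ} (hs : 0 < s) :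
    HasDerivAt (fun t => ∫ ω, Real.log (fm κ 0 t (X ω) (√t * Z ω + N ω)) ∂μ)
      (-(1 / 2) * ∫ ω, (Z ω - (μ[Z | sg X Z N s]) ω) ^ 2 ∂μ) s := by
  refine (hasDerivAt_entropy hX hZ hN hXZN hN_law hκ hIntg hs).congr_deriv ?_
  rw [mmse_eq hX hZ hN hXZN hN_law hκ hZ1 hs]
  field_simp

end deriv
end IMMSE

namespace IMMSE

section info
variable {Ω : Type*} [MeasurableSpace Ω] {μ : Measure Ω} [IsProbabilityMeasure μ]
    {α : Type*} [MeasurableSpace α] {X : Ω → α} {Z N : Ω → ℝ}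
    {κ : Kernel α ℝ} [IsMarkovKernel κ]

lemma neg_log_fm_le (s : ℝ) (x : α) (y : ℝ) (hz : Integrable (fun z => z ^ 2) (κ x)) :
    -Real.log (fm κ 0 s x y) ≤ Real.log √(2 * π) + (y ^ 2 + √s ^ 2 * ∫ z, z ^ 2 ∂κ x) := by
  have hb : Integrable (fun z => y ^ 2 + √s ^ 2 * z ^ 2) (κ x) :=
    (integrable_const _).add (hz.const_mul _)
  have hle : ∀ z, (y - √s * z) ^ 2 / 2 ≤ y ^ 2 + √s ^ 2 * z ^ 2 := fun z => by
    nlinarith [sq_nonneg (y + √s * z)]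
  have hA : Integrable (fun z => (y - √s * z) ^ 2 / 2) (κ x) := by
    refine hb.mono' (by fun_prop) (ae_of_all _ fun z => ?_)
    rw [Real.norm_of_nonneg (by positivity)]
    exact hle z
  set A := ∫ z, (y - √s * z) ^ 2 / 2 ∂κ x with hAdef
  have hA_le : A ≤ y ^ 2 + √s ^ 2 * ∫ z, z ^ 2 ∂κ x := by
    calc A ≤ ∫ z, (y ^ 2 + √s ^ 2 * z ^ 2) ∂κ x := integral_mono hA hb hle
      _ = _ := by rw [integral_add (integrable_const _) (hz.const_mul _), integral_const_mul]; simp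
  have h1 : (√(2 * π))⁻¹ * rexp (-A) ≤ fm κ 0 s x y := by
    have hi : Integrable (fun z => (√(2 * π))⁻¹ * (rexp (-A) * (1 + (A - (y - √s * z) ^ 2 / 2)))) (κ x) :=
      (((integrable_const _).add ((integrable_const _).sub hA)).const_mul _).const_mul _
    have hsub : Integrable (fun z => A - (y - √s * z) ^ 2 / 2) (κ x) :=
      (integrable_const _).sub hA
    calc (√(2 * π))⁻¹ * rexp (-A)
        = ∫ z, (√(2 * π))⁻¹ * (rexp (-A) * (1 + (A - (y - √s * z) ^ 2 / 2))) ∂κ x := by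
          rw [integral_const_mul, integral_const_mul, integral_add (integrable_const _)
            hsub, integral_sub (integrable_const _) hA, ← hAdef]
          simp
      _ ≤ ∫ z, ph (y - √s * z) ∂κ x := by
          refine integral_mono hi (integrable_ph κ s x y) fun z => ?_
          simp only [ph_eq]
          refine mul_le_mul_of_nonneg_left ?_ c_pos.le
          have h2 : rexp (-(y - √s * z) ^ 2 / 2) = rexp (-A) * rexp (A - (y - √s * z) ^ 2 / 2) := by
            rw [← Real.exp_add]; congr 1; ring
          rw [h2]
          refine mul_le_mul_of_nonneg_left ?_ (Real.exp_pos _).le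
          linarith [Real.add_one_le_exp (A - (y - √s * z) ^ 2 / 2)]
      _ = fm κ 0 s x y := (fm_zero_eq κ s x y).symm
  have h2 := Real.log_le_log (mul_pos c_pos (Real.exp_pos _)) h1
  rw [Real.log_mul c_pos.ne' (Real.exp_pos _).ne', Real.log_inv, Real.log_exp] at h2
  linarith

lemma integrable_log (hX : Measurable X) (hZ : Measurable Z) (hN : Measurable N)
    (hN_law : μ.map N = gaussianReal 0 1)
    (hκ : μ.map (fun ω => (X ω, Z ω)) = μ.map X ⊗ₘ κ)
    (hZ2 : Integrable (fun ω => Z ω ^ 2) μ) (s : ℝ) :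
    Integrable (fun ω => Real.log (fm κ 0 s (X ω) (√s * Z ω + N ω))) μ := by
  have hP : IsProbabilityMeasure (μ.map X) := Measure.isProbabilityMeasure_map hX.aemeasurable
  have h1 : Integrable (fun q : α × ℝ => q.2 ^ 2) (μ.map X ⊗ₘ κ) := by
    rw [← hκ, integrable_map_measure (by fun_prop) (by fun_prop)]
    exact hZ2
  have h3 := (Measure.integrable_compProd_iff h1.aestronglyMeasurable).1 h1
  have h2 : Integrable (fun x => ∫ z, z ^ 2 ∂κ x) (μ.map X) := by simpa using h3.2
  have h4 : Integrable (fun ω => ∫ z, z ^ 2 ∂κ (X ω)) μ := by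
    exact (integrable_map_measure h2.aestronglyMeasurable hX.aemeasurable).1 h2
  have h5 := ae_of_ae_map hX.aemeasurable h3.1
  have hZL : MemLp Z 2 μ := (memLp_two_iff_integrable_sq hZ.aestronglyMeasurable).2 hZ2
  have hY : Integrable (fun ω => (√s * Z ω + N ω) ^ 2) μ :=
    ((hZL.const_mul √s).add (memLp_N hN hN_law)).integrable_sq
  refine ((integrable_const (Real.log √(2 * π))).add
    (hY.add (h4.const_mul (√s ^ 2)))).mono'
    (measurable_path_fm hX hZ hN 0 s).log.aestronglyMeasurable ?_
  filter_upwards [h5] with ω hω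
  have h6 := Real.log_nonpos (fm_zero_pos κ s (X ω) (√s * Z ω + N ω)).le
    (fm_zero_le_one κ s (X ω) (√s * Z ω + N ω))
  rw [Real.norm_eq_abs, abs_of_nonpos h6]
  exact neg_log_fm_le s (X ω) _ hω

/-- Output law. -/
lemma map_output (hZ : Measurable Z) (hN : Measurable N)
    (hZN : IndepFun (fun ω => ((), Z ω)) N μ) (hN_law : μ.map N = gaussianReal 0 1)
    {κ₀ : Kernel Unit ℝ} [IsMarkovKernel κ₀]
    (hκ₀ : μ.map (fun ω => ((), Z ω)) = μ.map (fun _ => ()) ⊗ₘ κ₀) (s : ℝ) :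
    μ.map (fun ω => √s * Z ω + N ω)
      = volume.withDensity (fun y => ENNReal.ofReal (fm κ₀ 0 s () y)) := by
  ext S hS
  rw [← lintegral_indicator_one hS, lintegral_map (measurable_one.indicator hS) (by fun_prop),
    lintegral_law₂ (X := fun _ => ()) measurable_const hZ hN hZN hN_law hκ₀ s
      (F := fun _ y => S.indicator 1 y) ((measurable_one.indicator hS).comp measurable_snd),
    withDensity_apply _ hS, ← lintegral_indicator hS]
  simp only [Measure.map_const, measure_univ, one_smul, lintegral_dirac]
  refine lintegral_congr fun y => ?_
  by_cases hy : y ∈ S <;> simp [hy]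

lemma mutualInfo_eq (hX : Measurable X) (hZ : Measurable Z) (hN : Measurable N)
    (hXZN : IndepFun (fun ω => (X ω, Z ω)) N μ) (hN_law : μ.map N = gaussianReal 0 1)
    (hκ : μ.map (fun ω => (X ω, Z ω)) = μ.map X ⊗ₘ κ)
    (hZN : IndepFun (fun ω => ((), Z ω)) N μ)
    {κ₀ : Kernel Unit ℝ} [IsMarkovKernel κ₀]
    (hκ₀ : μ.map (fun ω => ((), Z ω)) = μ.map (fun _ => ()) ⊗ₘ κ₀)
    (hZ2 : Integrable (fun ω => Z ω ^ 2) μ) (s : ℝ) :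
    (mutualInfo μ X (fun ω => √s * Z ω + N ω)).toReal
      = ∫ ω, Real.log (fm κ 0 s (X ω) (√s * Z ω + N ω)) ∂μ
        - ∫ ω, Real.log (fm κ₀ 0 s () (√s * Z ω + N ω)) ∂μ := by
  have hY : Measurable (fun ω => √s * Z ω + N ω) := by fun_prop
  have hXY : Measurable (fun ω => (X ω, √s * Z ω + N ω)) := by fun_prop
  have hPX : IsProbabilityMeasure (μ.map X) := Measure.isProbabilityMeasure_map hX.aemeasurable
  have hPY : IsProbabilityMeasure (μ.map (fun ω => √s * Z ω + N ω)) :=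
    Measure.isProbabilityMeasure_map hY.aemeasurable
  have hPXY : IsProbabilityMeasure (μ.map (fun ω => (X ω, √s * Z ω + N ω))) :=
    Measure.isProbabilityMeasure_map hXY.aemeasurable
  have hm0 : Measurable (fun y => fm κ₀ 0 s () y) :=
    (measurable_fm κ₀ 0 s).comp (f := fun y : ℝ => ((), y)) (by fun_prop)
  have hm : Measurable (fun q : α × ℝ => fm κ 0 s q.1 q.2) := measurable_fm κ 0 s
  have hm0' : Measurable (fun q : α × ℝ => fm κ₀ 0 s () q.2) := hm0.comp measurable_snd
  set ρ := (μ.map X).prod (μ.map (fun ω => √s * Z ω + N ω)) with hρ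
  set r : α × ℝ → ℝ := fun q => fm κ 0 s q.1 q.2 / fm κ₀ 0 s () q.2 with hr
  have hrm : Measurable r := hm.div hm0'
  have hrpos : ∀ q, 0 < r q := fun q => div_pos (fm_zero_pos κ _ _ _) (fm_zero_pos κ₀ _ _ _)
  have hwd : μ.map (fun ω => (X ω, √s * Z ω + N ω))
      = ρ.withDensity (fun q => ENNReal.ofReal (r q)) := by
    ext S hS
    rw [← lintegral_indicator_one hS, lintegral_map (measurable_one.indicator hS) hXY,
      lintegral_law₂ hX hZ hN hXZN hN_law hκ s (F := fun x y => S.indicator 1 (x, y))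
        (measurable_one.indicator hS), withDensity_apply _ hS, ← lintegral_indicator hS, hρ,
      lintegral_prod _ (hrm.ennreal_ofReal.indicator hS).aemeasurable]
    refine lintegral_congr fun x => ?_
    have hmx : Measurable (fun y => S.indicator (fun q => ENNReal.ofReal (r q)) (x, y)) :=
      (hrm.ennreal_ofReal.indicator hS).comp measurable_prodMk_left
    rw [map_output hZ hN hZN hN_law hκ₀ s,
      lintegral_withDensity_eq_lintegral_mul _ hm0.ennreal_ofReal hmx]
    refine lintegral_congr fun y => ?_
    have h0 := fm_zero_pos κ₀ s () y
    by_cases hy : (x, y) ∈ S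
    · simp only [Set.indicator, hy, if_true, Pi.one_apply, mul_one, Pi.mul_apply, hr]
      rw [← ENNReal.ofReal_mul h0.le, mul_div_cancel₀ _ h0.ne']
    · simp [Set.indicator, hy]
  have hac : μ.map (fun ω => (X ω, √s * Z ω + N ω)) ≪ ρ := by
    rw [hwd]; exact withDensity_absolutelyContinuous _ _
  have hllr : llr (μ.map (fun ω => (X ω, √s * Z ω + N ω))) ρ
      =ᵐ[μ.map (fun ω => (X ω, √s * Z ω + N ω))] fun q => Real.log (r q) := by
    have h := Measure.rnDeriv_withDensity ρ hrm.ennreal_ofReal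
    rw [← hwd] at h
    filter_upwards [hac.ae_le h] with q hq
    rw [llr, hq, ENNReal.toReal_ofReal (hrpos q).le]
  have hi1 := integrable_log (κ := κ) hX hZ hN hN_law hκ hZ2 s
  have hi0 := integrable_log (X := fun _ => ()) (κ := κ₀) measurable_const hZ hN hN_law hκ₀ hZ2 s
  have hlog : ∀ ω, Real.log (r (X ω, √s * Z ω + N ω))
      = Real.log (fm κ 0 s (X ω) (√s * Z ω + N ω)) - Real.log (fm κ₀ 0 s () (√s * Z ω + N ω)) :=
    fun ω => Real.log_div (fm_zero_pos κ _ _ _).ne' (fm_zero_pos κ₀ _ _ _).ne'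
  have hIntg : Integrable (llr (μ.map (fun ω => (X ω, √s * Z ω + N ω))) ρ)
      (μ.map (fun ω => (X ω, √s * Z ω + N ω))) := by
    rw [integrable_congr hllr, integrable_map_measure hrm.log.aestronglyMeasurable hXY.aemeasurable]
    refine (hi1.sub hi0).congr (ae_of_all _ fun ω => (hlog ω).symm)
  have hnn := InformationTheory.integral_llr_add_sub_measure_univ_nonneg hac hIntg
  simp only [measureReal_def, measure_univ, add_sub_cancel_right] at hnn
  rw [mutualInfo, klDiv, if_pos ⟨hac, hIntg⟩, ENNReal.toReal_ofReal hnn, integral_congr_ae hllr,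
    integral_map hXY.aemeasurable hrm.log.aestronglyMeasurable, ← integral_sub hi1 hi0]
  exact integral_congr_ae (ae_of_all _ hlog)

end info
end IMMSE

/-- **I-MMSE relation with preprocessing** (Theorem 8): if `X — Z — Y` is a Markov chain with
`Y = √snr · Z + N`, then for every `snr > 0`,
`d/dsnr I(X; Y) = (1/2) E[(Z − E[Z | Y])²] − (1/2) E[(Z − E[Z | Y, X])²]`. -/
theorem hasDerivAt_mutualInfo_preprocessed
    {Ω : Type*} [MeasurableSpace Ω] (μ : Measure Ω) [IsProbabilityMeasure μ]
    {α : Type*} [MeasurableSpace α] [StandardBorelSpace α]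
    (X : Ω → α) (Z N : Ω → ℝ)
    (hX : Measurable X) (hZ : Measurable Z) (hN : Measurable N)
    (hXZN : IndepFun (fun ω => (X ω, Z ω)) N μ)
    (hN_law : μ.map N = gaussianReal 0 1)
    (hZ2 : Integrable (fun ω => Z ω ^ 2) μ) :
    ∀ snr ∈ Set.Ioi (0 : ℝ),
      HasDerivAt
        (fun s : ℝ => (mutualInfo μ X (fun ω => Real.sqrt s * Z ω + N ω)).toReal)
        ((1 / 2) * (∫ ω, (Z ω -
            (μ[Z | MeasurableSpace.comap (fun ω' => Real.sqrt snr * Z ω' + N ω')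
                inferInstance]) ω) ^ 2 ∂μ)
          - (1 / 2) * (∫ ω, (Z ω -
            (μ[Z | MeasurableSpace.comap
                (fun ω' => (Real.sqrt snr * Z ω' + N ω', X ω')) inferInstance]) ω) ^ 2 ∂μ))
        snr := by
  intro s hs
  have hs : 0 < s := hs
  have hZL : MemLp Z 2 μ := (memLp_two_iff_integrable_sq hZ.aestronglyMeasurable).2 hZ2
  have hZ1 : Integrable Z μ := hZL.integrable (by norm_num)
  have hκ : μ.map (fun ω => (X ω, Z ω)) = μ.map X ⊗ₘ condDistrib Z X μ :=
    (compProd_map_condDistrib hZ.aemeasurable).symm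
  have hκ₀ : μ.map (fun ω => ((), Z ω))
      = μ.map (fun _ => ()) ⊗ₘ condDistrib Z (fun _ : Ω => ()) μ :=
    (compProd_map_condDistrib hZ.aemeasurable).symm
  have hZN : IndepFun (fun ω => ((), Z ω)) N μ :=
    hXZN.comp (φ := fun q : α × ℝ => ((), q.2)) (ψ := id) (by fun_prop) measurable_id
  have h1 := IMMSE.hasDerivAt_entropy_mmse hX hZ hN hXZN hN_law hκ hZ1
    (IMMSE.integrable_log hX hZ hN hN_law hκ hZ2) hs
  have h0 := IMMSE.hasDerivAt_entropy_mmse (X := fun _ => ()) measurable_const hZ hN hZN hN_law hκ₀ hZ1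
    (IMMSE.integrable_log measurable_const hZ hN hN_law hκ₀ hZ2) hs
  have hsg : IMMSE.sg (fun _ : Ω => ()) Z N s
      = MeasurableSpace.comap (fun ω' => Real.sqrt s * Z ω' + N ω') inferInstance := by
    apply le_antisymm
    · apply Measurable.comap_le
      exact (comap_measurable _).prodMk measurable_const
    · apply Measurable.comap_le
      exact measurable_fst.comp (comap_measurable (fun ω => (√s * Z ω + N ω, ())))
  rw [hsg] at h0
  have h := h1.sub h0
  refine (h.congr_deriv ?_).congr_of_eventuallyEq (Eventually.of_forall fun t => ?_)
  · unfold IMMSE.sg; ring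
  · exact IMMSE.mutualInfo_eq hX hZ hN hXZN hN_law hκ hZN hκ₀ hZ2 t
end
end
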